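/- Sharp lower bound near extinction: let m ∈ (m_s, 1) and let u be a radial energy solution of the fast diffusion equation with exponent m and extinction time T > 0. Then for every ε ∈ (0,T) there exists a constant P′ > 0 (depending on u_0, m, N, ε) such that u(r,t) ≥ P′ e^{−(N−1)r/m} (T − t)^{1/(1−m)} for all r ≥ 0 and all t ∈ [ε, T). -/

import Mathlib

open MeasureTheory Set Filter Topology

/-- Membership in the radial energy space `H¹_rad` on hyperbolic space `ℍ^N`:
`v` is locally absolutely continuous on `(0,∞)` (expressed via the fundamental theorem
of calculus for its a.e. derivative) and both `v` and `v'` are square-integrable with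
respect to the weight `(sinh s)^(N-1)`. -/
def MemH1rad (N : ℕ) (v : ℝ → ℝ) : Prop :=
  (∀ a b : ℝ, 0 < a → a ≤ b → v b - v a = ∫ s in a..b, deriv v s) ∧
  MeasureTheory.IntegrableOn (fun s => (v s) ^ 2 * Real.sinh s ^ (N - 1)) (Set.Ioi 0) ∧
  MeasureTheory.IntegrableOn (fun s => (deriv v s) ^ 2 * Real.sinh s ^ (N - 1)) (Set.Ioi 0)

/-- The squared `H¹` norm `‖v‖_2² + ‖v'‖_2²` with weight `(sinh s)^(N-1)`. -/
noncomputable def H1normSq (N : ℕ) (v : ℝ → ℝ) : ℝ :=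
  (∫ s in Set.Ioi (0:ℝ), (v s) ^ 2 * Real.sinh s ^ (N - 1)) +
  (∫ s in Set.Ioi (0:ℝ), (deriv v s) ^ 2 * Real.sinh s ^ (N - 1))

/-- A radial energy solution of the fast diffusion equation `u_t = Δ(u^m)` on `ℍ^N`,
with exponent `m`, extinction time `T` (initial datum `u(·,0)`). -/
structure IsRadialEnergySolution (N : ℕ) (m T : ℝ) (u : ℝ → ℝ → ℝ) : Prop where
  continuousOn : ContinuousOn (fun p : ℝ × ℝ => u p.1 p.2) (Set.Ici 0 ×ˢ Set.Icc 0 T)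
  nonneg : ∀ r ∈ Set.Ici (0:ℝ), ∀ t ∈ Set.Icc (0:ℝ) T, 0 ≤ u r t
  smooth : ContDiffOn ℝ (⊤ : ℕ∞) (fun p : ℝ × ℝ => u p.1 p.2) (Set.Ici 0 ×ˢ Set.Ioo 0 T)
  pos : ∀ r ∈ Set.Ici (0:ℝ), ∀ t ∈ Set.Ioo (0:ℝ) T, 0 < u r t
  pde : ∀ r > (0:ℝ), ∀ t ∈ Set.Ioo (0:ℝ) T,
    deriv (fun τ => u r τ) t
      = deriv (deriv (fun ρ => u ρ t ^ m)) r
        + ((N : ℝ) - 1) * (Real.cosh r / Real.sinh r) * deriv (fun ρ => u ρ t ^ m) r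
  neumann : ∀ t ∈ Set.Ioo (0:ℝ) T, deriv (fun ρ => u ρ t ^ m) 0 = 0
  extinction : ∀ r ∈ Set.Ici (0:ℝ), u r T = 0
  energy : ∀ t ∈ Set.Ioo (0:ℝ) T, MemH1rad N (fun ρ => u ρ t ^ m)
  energy_bdd : ∀ ε ∈ Set.Ioo (0:ℝ) T, ∃ C : ℝ, ∀ t ∈ Set.Ico ε T,
    H1normSq N (fun ρ => u ρ t ^ m) ≤ C
  init_bdd : ∃ M : ℝ, ∀ r ∈ Set.Ici (0:ℝ), u r 0 ≤ M
  init_nonzero : ∃ r ∈ Set.Ici (0:ℝ), u r 0 ≠ 0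
  init_energy : MemH1rad N (fun ρ => u ρ 0 ^ m)


noncomputable def wt (N : ℕ) (r : ℝ) : ℝ := Real.sinh r ^ (N - 1)
noncomputable def gg (N : ℕ) (r : ℝ) : ℝ := ∫ ρ in Ioi r, (wt N ρ)⁻¹

lemma wt_pos {N : ℕ} {r : ℝ} (h : 0 < r) : 0 < wt N r := pow_pos (Real.sinh_pos_iff.2 h) _
lemma wt_cont (N : ℕ) : Continuous (wt N) := by unfold wt; fun_prop
lemma wt_nonneg {N : ℕ} {r : ℝ} (h : 0 ≤ r) : 0 ≤ wt N r := pow_nonneg (Real.sinh_nonneg_iff.2 h) _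

lemma wtinv_cont (N : ℕ) : ContinuousOn (fun ρ => (wt N ρ)⁻¹) (Ioi 0) :=
  (wt_cont N).continuousOn.inv₀ (fun x hx => (wt_pos hx).ne')

lemma wtinv_le {N : ℕ} (hN : 2 ≤ N) {r0 : ℝ} (h0 : 0 < r0) :
    ∃ C > 0, ∀ ρ ≥ r0, (wt N ρ)⁻¹ ≤ C * Real.exp (-((N:ℝ)-1) * ρ) := by
  set c := (1 - Real.exp (-2*r0))/2 with hc
  have hcpos : 0 < c := by
    have : Real.exp (-2*r0) < 1 := by rw [Real.exp_lt_one_iff]; linarith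
    rw [hc]; linarith
  refine ⟨(c^(N-1))⁻¹, by positivity, fun ρ hρ => ?_⟩
  have h1 : c * Real.exp ρ ≤ Real.sinh ρ := by
    rw [Real.sinh_eq, hc]
    have h2 : Real.exp (-ρ) = Real.exp (-2*ρ) * Real.exp ρ := by rw [← Real.exp_add]; ring_nf
    have h3 : Real.exp (-2*ρ) ≤ Real.exp (-2*r0) := Real.exp_le_exp.2 (by linarith)
    rw [h2]
    nlinarith [Real.exp_pos ρ]
  have h4 : (c * Real.exp ρ)^(N-1) ≤ wt N ρ := pow_le_pow_left₀ (by positivity) h1 _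
  have h5 : (wt N ρ)⁻¹ ≤ ((c * Real.exp ρ)^(N-1))⁻¹ := inv_anti₀ (by positivity) h4
  refine h5.trans (le_of_eq ?_)
  rw [mul_pow, mul_inv, ← Real.exp_nat_mul, ← Real.exp_neg]
  congr 2
  push_cast [Nat.cast_sub (by omega : 1 ≤ N)]
  ring

lemma wtinv_int {N : ℕ} (hN : 2 ≤ N) {r : ℝ} (h0 : 0 < r) :
    IntegrableOn (fun ρ => (wt N ρ)⁻¹) (Ioi r) := by
  obtain ⟨C, hC, h⟩ := wtinv_le hN h0
  have hN' : (2:ℝ) ≤ N := by exact_mod_cast hN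
  have h1 : IntegrableOn (fun ρ => C * Real.exp (-((N:ℝ)-1) * ρ)) (Ioi r) :=
    (integrableOn_exp_mul_Ioi (by linarith) r).const_mul C
  refine Integrable.mono' h1 ?_ ?_
  · exact ((wtinv_cont N).mono (Ioi_subset_Ioi h0.le)).aestronglyMeasurable measurableSet_Ioi
  · filter_upwards [ae_restrict_mem measurableSet_Ioi] with x hx
    rw [Real.norm_of_nonneg (inv_nonneg.2 (wt_pos (h0.trans hx)).le)]
    exact h x (le_of_lt hx)

lemma wtinv_ii {N : ℕ} (hN : 2 ≤ N) {r R : ℝ} (h0 : 0 < r) (hR : 0 < R) :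
    IntervalIntegrable (fun ρ => (wt N ρ)⁻¹) volume r R := by
  apply ContinuousOn.intervalIntegrable
  apply (wtinv_cont N).mono
  intro x hx
  rcases le_total r R with h | h
  · rw [uIcc_of_le h] at hx; exact h0.trans_le hx.1
  · rw [uIcc_of_ge h] at hx; exact hR.trans_le hx.1

lemma gg_sub {N : ℕ} (hN : 2 ≤ N) {r R : ℝ} (h0 : 0 < r) (hR : 0 < R) :
    gg N r - gg N R = ∫ ρ in r..R, (wt N ρ)⁻¹ := by
  unfold gg
  rw [intervalIntegral.integral_Ioi_sub_Ioi' (wtinv_int hN h0) (wtinv_int hN hR)]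

lemma gg_lb {N : ℕ} (hN : 2 ≤ N) {r : ℝ} (h0 : 0 < r) :
    (1/((N:ℝ)-1)) * Real.exp (-((N:ℝ)-1) * r) ≤ gg N r := by
  have hN' : (2:ℝ) ≤ N := by exact_mod_cast hN
  have h1 : ∫ ρ in Ioi r, Real.exp (-((N:ℝ)-1) * ρ) = (1/((N:ℝ)-1)) * Real.exp (-((N:ℝ)-1) * r) := by
    rw [integral_exp_mul_Ioi (by linarith)]
    have : (N:ℝ)-1 ≠ 0 := by linarith
    rw [neg_div, div_neg]; ring
  rw [← h1]
  apply setIntegral_mono_on (integrableOn_exp_mul_Ioi (by linarith) r) (wtinv_int hN h0) measurableSet_Ioi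
  intro x hx
  have hx0 : 0 < x := h0.trans hx
  have h2 : Real.sinh x ≤ Real.exp x := by
    rw [Real.sinh_eq]; linarith [Real.exp_pos x, Real.exp_pos (-x)]
  have h3 : wt N x ≤ Real.exp x ^ (N-1) := pow_le_pow_left₀ (Real.sinh_pos_iff.2 hx0).le h2 _
  refine le_trans (le_of_eq ?_) (inv_anti₀ (wt_pos hx0) h3)
  rw [← Real.exp_nat_mul, ← Real.exp_neg]
  congr 1
  push_cast [Nat.cast_sub (by omega : 1 ≤ N)]
  ring

lemma gg_pos {N : ℕ} (hN : 2 ≤ N) {r : ℝ} (h0 : 0 < r) : 0 < gg N r := by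
  have hN' : (2:ℝ) ≤ N := by exact_mod_cast hN
  have : 0 < (N:ℝ)-1 := by linarith
  exact lt_of_lt_of_le (by positivity) (gg_lb hN h0)

lemma gg_anti {N : ℕ} (hN : 2 ≤ N) : AntitoneOn (gg N) (Ioi 0) := by
  intro r hr R hR h
  have h1 := gg_sub hN hr hR
  have h2 : 0 ≤ ∫ ρ in r..R, (wt N ρ)⁻¹ :=
    intervalIntegral.integral_nonneg h (fun x hx => inv_nonneg.2 (wt_pos (lt_of_lt_of_le hr hx.1)).le)
  linarith

lemma gg_ub {N : ℕ} (hN : 2 ≤ N) {r0 : ℝ} (h0 : 0 < r0) :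
    ∃ C > 0, ∀ r ≥ r0, gg N r ≤ C * Real.exp (-((N:ℝ)-1) * r) := by
  obtain ⟨C, hC, h⟩ := wtinv_le hN h0
  have hN' : (2:ℝ) ≤ N := by exact_mod_cast hN
  have hN1 : 0 < (N:ℝ)-1 := by linarith
  refine ⟨C * (1/((N:ℝ)-1)), by positivity, fun r hr => ?_⟩
  have h1 : ∫ ρ in Ioi r, Real.exp (-((N:ℝ)-1) * ρ) = (1/((N:ℝ)-1)) * Real.exp (-((N:ℝ)-1) * r) := by
    rw [integral_exp_mul_Ioi (by linarith)]
    rw [neg_div, div_neg]; ring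
  rw [mul_assoc, ← h1, ← integral_const_mul]
  apply setIntegral_mono_on (wtinv_int hN (h0.trans_le hr))
    ((integrableOn_exp_mul_Ioi (by linarith) r).const_mul C) measurableSet_Ioi
  intro x hx
  exact h x (hr.trans (le_of_lt hx))

lemma gg_ub0 {N : ℕ} (hN : 2 ≤ N) {a : ℝ} (ha : 0 < a) (haN : (N:ℝ) - 2 ≤ a) :
    ∃ C > 0, ∀ r ∈ Ioc (0:ℝ) 1, gg N r ≤ C * r ^ (-a) := by
  have g1 := gg_pos hN one_pos
  refine ⟨1/a + gg N 1, by positivity, fun r hr => ?_⟩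
  have h1 := gg_sub hN hr.1 one_pos
  have hle : ∫ ρ in r..1, (wt N ρ)⁻¹ ≤ ∫ ρ in r..1, ρ ^ (-a-1) := by
    apply intervalIntegral.integral_mono_on hr.2 (wtinv_ii hN hr.1 one_pos)
    · apply intervalIntegral.intervalIntegrable_rpow
      right
      rw [uIcc_of_le hr.2]
      intro h; linarith [h.1, hr.1]
    · intro x hx
      have hx0 : 0 < x := hr.1.trans_le hx.1
      have h2 : x ^ (N-1) ≤ wt N x := pow_le_pow_left₀ hx0.le (Real.self_le_sinh_iff.2 hx0.le) _
      refine (inv_anti₀ (by positivity) h2).trans ?_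
      rw [← Real.rpow_natCast, ← Real.rpow_neg hx0.le]
      apply Real.rpow_le_rpow_of_exponent_ge hx0 hx.2
      push_cast [Nat.cast_sub (by omega : 1 ≤ N)]
      linarith
  have h3 : ∫ ρ in r..1, ρ ^ (-a-1) = (r^(-a) - 1)/a := by
    rw [integral_rpow]
    · rw [show -a-1+1 = -a by ring, Real.one_rpow, div_neg, ← neg_div]; ring
    · right
      refine ⟨by linarith, ?_⟩
      rw [uIcc_of_le hr.2]
      intro h; linarith [h.1, hr.1]
  have h4 : 1 ≤ r^(-a) := Real.one_le_rpow_of_pos_of_le_one_of_nonpos hr.1 hr.2 (by linarith)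
  have h5 : (r^(-a) - 1)/a ≤ 1/a * r^(-a) := by
    rw [div_mul_eq_mul_div, one_mul]
    exact div_le_div_of_nonneg_right (by linarith) ha.le
  have h6 : gg N 1 ≤ gg N 1 * r^(-a) := by nlinarith
  linarith

lemma gg_meas {N : ℕ} (hN : 2 ≤ N) : AEMeasurable (gg N) (volume.restrict (Ioi 0)) :=
  aemeasurable_restrict_of_antitoneOn measurableSet_Ioi (gg_anti hN)

lemma ggp_int {N : ℕ} (hN : 2 ≤ N) {p : ℝ} (hp : 1 < p) (hpN : p * ((N:ℝ)-2) < N) :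
    IntegrableOn (fun r => gg N r ^ p * wt N r) (Ioi 0) := by
  have hN' : (2:ℝ) ≤ N := by exact_mod_cast hN
  have hmeas : AEMeasurable (fun r => gg N r ^ p * wt N r) (volume.restrict (Ioi 0)) :=
    ((gg_meas hN).pow_const p).mul (wt_cont N).measurable.aemeasurable
  have hp0 : 0 < p := by linarith
  obtain ⟨a, ha1, ha2⟩ : ∃ a, (N:ℝ)-2 < a ∧ a < N/p := by
    apply exists_between
    rw [lt_div_iff₀ hp0]; linarith
  rw [lt_div_iff₀ hp0] at ha2
  have ha : 0 < a := by linarith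
  rw [← Ioc_union_Ioi_eq_Ioi (zero_le_one (α := ℝ))]
  apply IntegrableOn.union
  · obtain ⟨C, hC, h⟩ := gg_ub0 hN ha ha1.le
    have hi : IntegrableOn (fun r : ℝ => C^p * (Real.cosh 1)^(N-1) * r^(-a*p+(N-1))) (Ioc 0 1) := by
      apply Integrable.const_mul
      have := intervalIntegral.intervalIntegrable_rpow' (a := 0) (b := 1) (r := -a*p+(N-1)) (by linarith)
      rwa [intervalIntegrable_iff_integrableOn_Ioc_of_le zero_le_one] at this
    refine Integrable.mono' hi (hmeas.mono_measure (Measure.restrict_mono Ioc_subset_Ioi_self le_rfl)).aestronglyMeasurable ?_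
    filter_upwards [ae_restrict_mem measurableSet_Ioc] with r hr
    have hg := gg_pos hN hr.1
    rw [Real.norm_of_nonneg (mul_nonneg (Real.rpow_nonneg hg.le _) (wt_nonneg hr.1.le))]
    have e1 : gg N r ^ p ≤ C^p * r^(-a*p) := by
      calc gg N r ^ p ≤ (C * r^(-a))^p := Real.rpow_le_rpow hg.le (h r hr) hp0.le
        _ = _ := by rw [Real.mul_rpow hC.le (Real.rpow_nonneg hr.1.le _), ← Real.rpow_mul hr.1.le]
    have e2 : Real.sinh r ≤ Real.cosh 1 * r := by
      have hmv := Convex.norm_image_sub_le_of_norm_deriv_le (f := Real.sinh) (s := Icc 0 1) (x := 0) (y := r) (C := Real.cosh 1)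
        (fun x _ => Real.differentiable_sinh x) (fun x hx => by
          rw [Real.deriv_sinh, Real.norm_of_nonneg (Real.cosh_pos x).le, Real.cosh_le_cosh, abs_of_nonneg hx.1]
          simpa using hx.2) (convex_Icc _ _) (by simp) ⟨hr.1.le, hr.2⟩
      simp only [Real.sinh_zero, sub_zero] at hmv
      rw [Real.norm_of_nonneg hr.1.le] at hmv
      exact (le_abs_self _).trans hmv
    have e3 : wt N r ≤ (Real.cosh 1)^(N-1) * r^((N:ℝ)-1) := by
      calc wt N r ≤ (Real.cosh 1 * r)^(N-1) := pow_le_pow_left₀ (Real.sinh_nonneg_iff.2 hr.1.le) e2 _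
        _ = _ := by
          rw [mul_pow]
          congr 1
          rw [← Real.rpow_natCast]; congr 1
          push_cast [Nat.cast_sub (by omega : 1 ≤ N)]; ring
    calc gg N r ^ p * wt N r ≤ (C^p * r^(-a*p)) * ((Real.cosh 1)^(N-1) * r^((N:ℝ)-1)) :=
          mul_le_mul e1 e3 (wt_nonneg hr.1.le) (mul_nonneg (by positivity) (Real.rpow_nonneg hr.1.le _))
      _ = _ := by rw [Real.rpow_add hr.1]; ring
  · obtain ⟨C, hC, h⟩ := gg_ub hN one_pos
    have hi : IntegrableOn (fun r : ℝ => C^p * Real.exp ((-((N:ℝ)-1)*(p-1)) * r)) (Ioi 1) := by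
      apply Integrable.const_mul
      apply integrableOn_exp_mul_Ioi
      nlinarith
    refine Integrable.mono' hi (hmeas.mono_measure (Measure.restrict_mono (Ioi_subset_Ioi zero_le_one) le_rfl)).aestronglyMeasurable ?_
    filter_upwards [ae_restrict_mem measurableSet_Ioi] with r hr
    have hr0 : 0 < r := lt_trans one_pos hr
    have hg := gg_pos hN hr0
    rw [Real.norm_of_nonneg (mul_nonneg (Real.rpow_nonneg hg.le _) (wt_nonneg hr0.le))]
    have e1 : gg N r ^ p ≤ C^p * Real.exp (-((N:ℝ)-1)*r*p) := by
      calc gg N r ^ p ≤ (C * Real.exp (-((N:ℝ)-1)*r))^p := Real.rpow_le_rpow hg.le (h r (le_of_lt hr)) hp0.le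
        _ = _ := by rw [Real.mul_rpow hC.le (Real.exp_pos _).le, ← Real.exp_mul]
    have h2 : Real.sinh r ≤ Real.exp r := by
      rw [Real.sinh_eq]; linarith [Real.exp_pos r, Real.exp_pos (-r)]
    have h3 : wt N r ≤ Real.exp (((N:ℝ)-1)*r) := by
      calc wt N r ≤ Real.exp r ^ (N-1) := pow_le_pow_left₀ (Real.sinh_pos_iff.2 hr0).le h2 _
        _ = _ := by
          rw [← Real.exp_nat_mul]
          congr 1
          push_cast [Nat.cast_sub (by omega : 1 ≤ N)]
          ring
    calc gg N r ^ p * wt N r ≤ (C^p * Real.exp (-((N:ℝ)-1)*r*p)) * Real.exp (((N:ℝ)-1)*r) :=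
          mul_le_mul e1 h3 (wt_nonneg hr0.le) (by positivity)
      _ = _ := by rw [mul_assoc, ← Real.exp_add]; congr 2; ring


lemma cs_lemma {α : Type*} [MeasurableSpace α] {μ : Measure α} {f g : α → ℝ}
    (hf : AEStronglyMeasurable f μ) (hg : AEStronglyMeasurable g μ)
    (hf2 : Integrable (fun x => f x ^ 2) μ) (hg2 : Integrable (fun x => g x ^ 2) μ) :
    Integrable (fun x => f x * g x) μ ∧
      (∫ x, f x * g x ∂μ) ^ 2 ≤ (∫ x, f x ^ 2 ∂μ) * ∫ x, g x ^ 2 ∂μ := by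
  have hi : Integrable (fun x => f x * g x) μ := by
    refine (hf2.add hg2).mono' (hf.mul hg) (ae_of_all _ fun x => ?_)
    simp only [Pi.add_apply, Real.norm_eq_abs]
    rw [abs_le]
    constructor <;> nlinarith [sq_nonneg (f x + g x), sq_nonneg (f x - g x)]
  refine ⟨hi, ?_⟩
  have key : ∀ x : ℝ, 0 ≤ (∫ a, f a ^ 2 ∂μ) * (x * x) + (-2 * ∫ a, f a * g a ∂μ) * x + ∫ a, g a ^ 2 ∂μ := by
    intro x
    have h0 : 0 ≤ ∫ a, (x * f a - g a)^2 ∂μ := integral_nonneg fun a => sq_nonneg _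
    have h1 : ∫ a, (x * f a - g a)^2 ∂μ = ∫ a, ((x*x) * f a ^ 2 + (-2*x) * (f a * g a)) + g a ^ 2 ∂μ := by
      congr 1; ext a; ring
    have hadd : Integrable (fun a => (x*x) * f a ^ 2 + (-2*x) * (f a * g a)) μ :=
      (hf2.const_mul _).add (hi.const_mul _)
    rw [h1, integral_add hadd hg2,
      integral_add (hf2.const_mul _) (hi.const_mul _), integral_const_mul, integral_const_mul] at h0
    linarith
  have := discrim_le_zero key
  unfold discrim at this
  nlinarith

lemma wcs {N : ℕ} (hN : 2 ≤ N) {r : ℝ} (hr : 0 < r) {f : ℝ → ℝ}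
    (hf : AEStronglyMeasurable f (volume.restrict (Ioi r)))
    (hi : IntegrableOn (fun x => f x ^ 2 * wt N x) (Ioi r)) :
    IntegrableOn f (Ioi r) ∧
      (∫ x in Ioi r, f x) ^ 2 ≤ gg N r * ∫ x in Ioi r, f x ^ 2 * wt N x := by
  have hk : AEStronglyMeasurable (fun x => Real.sqrt ((wt N x)⁻¹)) (volume.restrict (Ioi r)) := by
    have := (wt_cont N).measurable.inv.sqrt
    exact this.aestronglyMeasurable
  have hk' : AEStronglyMeasurable (fun x => f x * Real.sqrt (wt N x)) (volume.restrict (Ioi r)) :=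
    hf.mul (wt_cont N).measurable.sqrt.aestronglyMeasurable
  have e1 : EqOn (fun x => Real.sqrt ((wt N x)⁻¹) ^ 2) (fun x => (wt N x)⁻¹) (Ioi r) := fun x hx =>
    Real.sq_sqrt (inv_nonneg.2 (wt_pos (hr.trans hx)).le)
  have e2 : EqOn (fun x => (f x * Real.sqrt (wt N x)) ^ 2) (fun x => f x ^ 2 * wt N x) (Ioi r) := fun x hx => by
    simp only [mul_pow]
    rw [Real.sq_sqrt (wt_pos (hr.trans hx)).le]
  have e3 : EqOn (fun x => Real.sqrt ((wt N x)⁻¹) * (f x * Real.sqrt (wt N x))) f (Ioi r) := fun x hx => by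
    have h := wt_pos (N := N) (hr.trans hx)
    simp only []
    rw [mul_left_comm, ← Real.sqrt_mul (inv_nonneg.2 h.le), inv_mul_cancel₀ h.ne', Real.sqrt_one, mul_one]
  have := cs_lemma hk hk' ((integrableOn_congr_fun e1 measurableSet_Ioi).2 (wtinv_int hN hr))
    ((integrableOn_congr_fun e2 measurableSet_Ioi).2 hi)
  rw [setIntegral_congr_fun measurableSet_Ioi e1, setIntegral_congr_fun measurableSet_Ioi e2,
    setIntegral_congr_fun measurableSet_Ioi e3] at this
  exact ⟨(integrableOn_congr_fun e3 measurableSet_Ioi).1 this.1, this.2⟩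

lemma h1_decay {N : ℕ} (hN : 2 ≤ N) {w : ℝ → ℝ} (hw : MemH1rad N w) {r : ℝ} (hr : 0 < r) :
    w r ^ 2 ≤ gg N r * H1normSq N w := by
  obtain ⟨h1, h2, h3⟩ := hw
  have h3r : IntegrableOn (fun s => (deriv w s)^2 * wt N s) (Ioi r) := h3.mono_set (Ioi_subset_Ioi hr.le)
  obtain ⟨hi, hcs⟩ := wcs hN hr (measurable_deriv w).aestronglyMeasurable h3r
  have ht : Tendsto (fun b => w r + ∫ s in r..b, deriv w s) atTop (𝓝 (w r + ∫ s in Ioi r, deriv w s)) :=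
    (intervalIntegral_tendsto_integral_Ioi r hi tendsto_id).const_add _
  have ht2 : Tendsto w atTop (𝓝 (w r + ∫ s in Ioi r, deriv w s)) := by
    refine ht.congr' ?_
    filter_upwards [eventually_ge_atTop r] with b hb
    rw [← h1 r b hr hb]; ring
  have hz : (w r + ∫ s in Ioi r, deriv w s)^2 = 0 := by
    have hI : IntegrableOn (fun s => w s ^ 2) (Ioi r) := by
      have hb : IntegrableOn (fun s => (wt N r)⁻¹ * (w s ^ 2 * wt N s)) (Ioi r) :=
        (h2.mono_set (Ioi_subset_Ioi hr.le)).const_mul _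
      refine Integrable.mono' hb ?_ ?_
      · have := (h2.mono_set (Ioi_subset_Ioi hr.le)).aestronglyMeasurable.mul
          ((wt_cont N).measurable.inv.aestronglyMeasurable (μ := volume.restrict (Ioi r)))
        refine this.congr ?_
        filter_upwards [ae_restrict_mem measurableSet_Ioi] with x hx
        have h := wt_pos (N := N) (hr.trans hx)
        change w x ^ 2 * wt N x * (wt N x)⁻¹ = _
        field_simp
      · filter_upwards [ae_restrict_mem measurableSet_Ioi] with x hx
        rw [Real.norm_of_nonneg (sq_nonneg _)]
        have h := wt_pos (N := N) hr
        have hle : wt N r ≤ wt N x := pow_le_pow_left₀ (Real.sinh_pos_iff.2 hr).le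
          (Real.sinh_le_sinh.2 (le_of_lt hx)) _
        rw [inv_mul_eq_div, le_div_iff₀ h]
        exact mul_le_mul_of_nonneg_left hle (sq_nonneg _)
    refine IntegrableAtFilter.eq_zero_of_tendsto (μ := volume) (f := fun s => w s ^ 2) (l := atTop) ⟨Ioi r, Ioi_mem_atTop r, hI⟩ ?_ (ht2.pow 2)
    intro s hs
    rcases mem_atTop_sets.1 hs with ⟨b, hb⟩
    rw [← top_le_iff, ← Real.volume_Ici (a := b)]
    exact measure_mono hb
  have hz' : (∫ s in Ioi r, deriv w s) = - w r := by
    have := pow_eq_zero_iff (two_ne_zero) |>.1 hz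
    linarith
  rw [hz', neg_sq] at hcs
  refine hcs.trans (mul_le_mul_of_nonneg_left ?_ (gg_pos hN hr).le)
  unfold H1normSq
  have k1 : ∫ x in Ioi r, deriv w x ^ 2 * wt N x ≤ ∫ x in Ioi 0, deriv w x ^ 2 * wt N x := by
    apply setIntegral_mono_set h3 _ (Ioi_subset_Ioi hr.le).eventuallyLE
    filter_upwards [ae_restrict_mem measurableSet_Ioi] with x hx
    exact mul_nonneg (sq_nonneg _) (wt_nonneg (le_of_lt hx))
  have k2 : 0 ≤ ∫ s in Ioi (0:ℝ), w s ^ 2 * Real.sinh s ^ (N-1) := by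
    apply setIntegral_nonneg measurableSet_Ioi
    intro x hx
    exact mul_nonneg (sq_nonneg _) (wt_nonneg (le_of_lt hx))
  have k3 : ∫ x in Ioi 0, deriv w x ^ 2 * wt N x = ∫ s in Ioi (0:ℝ), deriv w s ^ 2 * Real.sinh s ^ (N-1) := rfl
  linarith


lemma pde_reg {N : ℕ} (hN : 2 ≤ N) {m T : ℝ} {u : ℝ → ℝ → ℝ}
    (hu : IsRadialEnergySolution N m T u) :
    ∃ Dt Wr : ℝ → ℝ → ℝ, ContinuousOn (Function.uncurry Dt) (Ici 0 ×ˢ Ioo 0 T) ∧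
      ContinuousOn (Function.uncurry Wr) (Ici 0 ×ˢ Ioo 0 T) ∧
      (∀ r ≥ 0, ∀ t ∈ Ioo 0 T, HasDerivAt (fun τ => u r τ) (Dt r t) t) ∧
      (∀ r > 0, ∀ t ∈ Ioo 0 T, HasDerivAt (fun ρ => u ρ t ^ m) (Wr r t) r) ∧
      (∀ r ≥ 0, ∀ t ∈ Ioo 0 T, wt N r * Wr r t = ∫ s in (0:ℝ)..r, wt N s * Dt s t) := by
  set S : Set (ℝ × ℝ) := Ici 0 ×ˢ Ioo 0 T with hS
  set f : ℝ × ℝ → ℝ := fun p => u p.1 p.2 with hf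
  have hSu : UniqueDiffOn ℝ S := (uniqueDiffOn_Ici 0).prod isOpen_Ioo.uniqueDiffOn
  have hsm := hu.smooth
  have hcD : ContinuousOn (fderivWithin ℝ f S) S := hsm.continuousOn_fderivWithin hSu (by simp)
  have hdiff : ∀ p ∈ S, HasFDerivWithinAt f (fderivWithin ℝ f S p) S p := fun p hp =>
    ((hsm.differentiableOn (by simp)) p hp).hasFDerivWithinAt
  have hcu : ContinuousOn f S := hsm.continuousOn
  set Dt : ℝ → ℝ → ℝ := fun r t => fderivWithin ℝ f S (r, t) (0, 1) with hDt
  set Dr : ℝ → ℝ → ℝ := fun r t => fderivWithin ℝ f S (r, t) (1, 0) with hDr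
  have cDt : ContinuousOn (Function.uncurry Dt) S := hcD.clm_apply continuousOn_const
  have cDr : ContinuousOn (Function.uncurry Dr) S := hcD.clm_apply continuousOn_const
  have dt : ∀ r ≥ 0, ∀ t ∈ Ioo 0 T, HasDerivAt (fun τ => u r τ) (Dt r t) t := by
    intro r hr t ht
    have hc : HasDerivWithinAt (fun τ : ℝ => ((r, τ) : ℝ × ℝ)) (0, 1) (Ioo 0 T) t :=
      ((hasDerivAt_const t r).prodMk (hasDerivAt_id t)).hasDerivWithinAt
    have := (hdiff (r,t) ⟨hr, ht⟩).comp_hasDerivWithinAt t hc (fun τ hτ => ⟨hr, hτ⟩)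
    exact this.hasDerivAt (Ioo_mem_nhds ht.1 ht.2)
  have dr : ∀ r > 0, ∀ t ∈ Ioo 0 T, HasDerivAt (fun ρ => u ρ t) (Dr r t) r := by
    intro r hr t ht
    have hc : HasDerivWithinAt (fun ρ : ℝ => ((ρ, t) : ℝ × ℝ)) (1, 0) (Ici 0) r :=
      ((hasDerivAt_id r).prodMk (hasDerivAt_const r t)).hasDerivWithinAt
    have hp : (r, t) ∈ S := ⟨(le_of_lt hr : (0:ℝ) ≤ r), ht⟩
    have := (hdiff (r,t) hp).comp_hasDerivWithinAt r hc (fun ρ hρ => (⟨hρ, ht⟩ : (ρ, t) ∈ S))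
    exact this.hasDerivAt (Ici_mem_nhds hr)
  set Wr : ℝ → ℝ → ℝ := fun r t => Dr r t * m * u r t ^ (m - 1) with hWr
  have cWr : ContinuousOn (Function.uncurry Wr) S := by
    refine (cDr.mul continuousOn_const).mul (hcu.rpow_const ?_)
    intro p hp
    exact Or.inl (hu.pos p.1 hp.1 p.2 hp.2).ne'
  have dw : ∀ r > 0, ∀ t ∈ Ioo 0 T, HasDerivAt (fun ρ => u ρ t ^ m) (Wr r t) r := by
    intro r hr t ht
    exact (dr r hr t ht).rpow_const (Or.inl (hu.pos r (le_of_lt hr) t ht).ne')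
  refine ⟨Dt, Wr, cDt, cWr, dt, dw, ?_⟩
  intro r hr t ht
  have slice : ∀ {h : ℝ → ℝ → ℝ}, ContinuousOn (Function.uncurry h) S → ContinuousOn (fun s => h s t) (Icc 0 r) := by
    intro h hh
    exact hh.comp (f := fun s => (s, t)) (by fun_prop) (fun s hs => ⟨hs.1, ht⟩)
  have hcd : ContDiffOn ℝ 2 (fun ρ => u ρ t ^ m) (Ioi 0) := by
    have h1 : ContDiffOn ℝ 2 (fun ρ => u ρ t) (Ioi 0) := by
      have h2 : ContDiffOn ℝ 2 f S := hsm.of_le (WithTop.coe_le_coe.2 (le_top : (2:ℕ∞) ≤ ⊤))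
      exact h2.comp (f := fun ρ : ℝ => ((ρ, t) : ℝ × ℝ)) (by fun_prop) (fun s hs => ⟨(mem_Ioi.1 hs).le, ht⟩)
    exact h1.rpow_const_of_ne (fun x hx => (hu.pos x (mem_Ioi.1 hx).le t ht).ne')
  have hd2 : DifferentiableOn ℝ (deriv (fun ρ => u ρ t ^ m)) (Ioi 0) :=
    (hcd.deriv_of_isOpen isOpen_Ioi (m := 1) (by norm_num)).differentiableOn (by simp)
  have hflux : ∀ x ∈ Ioo 0 r, HasDerivAt (fun s => wt N s * Wr s t) (wt N x * Dt x t) x := by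
    intro x hx
    have e : (fun s => wt N s * Wr s t) =ᶠ[𝓝 x] fun s => wt N s * deriv (fun ρ => u ρ t ^ m) s := by
      filter_upwards [Ioi_mem_nhds hx.1] with s hs
      rw [(dw s hs t ht).deriv]
    refine HasDerivAt.congr_of_eventuallyEq ?_ e
    have hw2 := ((hd2 x hx.1).differentiableAt (Ioi_mem_nhds hx.1)).hasDerivAt
    have hwt : HasDerivAt (wt N) (((N - 1 : ℕ) : ℝ) * Real.sinh x ^ (N - 1 - 1) * Real.cosh x) x :=
      (Real.hasDerivAt_sinh x).pow (N-1)
    have := hwt.mul hw2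
    refine this.congr_deriv ?_
    have hp := hu.pde x hx.1 t ht
    rw [(dt x hx.1.le t ht).deriv] at hp
    rw [hp]
    have hs : Real.sinh x ≠ 0 := (Real.sinh_pos_iff.2 hx.1).ne'
    unfold wt
    obtain ⟨n, rfl⟩ : ∃ n, N = n + 2 := ⟨N - 2, by omega⟩
    simp only [show n + 2 - 1 = n + 1 by omega, show n + 1 - 1 = n by omega]
    push_cast
    field_simp
    ring
  have hcF : ContinuousOn (fun s => wt N s * Wr s t) (Icc 0 r) := (wt_cont N).continuousOn.mul (slice cWr)
  have hcI : ContinuousOn (fun s => wt N s * Dt s t) (Icc 0 r) := (wt_cont N).continuousOn.mul (slice cDt)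
  rw [intervalIntegral.integral_eq_sub_of_hasDerivAt_of_le hr hcF hflux
    (by apply ContinuousOn.intervalIntegrable; rwa [uIcc_of_le hr])]
  have : wt N 0 = 0 := by unfold wt; rw [Real.sinh_zero]; exact zero_pow (by omega)
  rw [this]; ring


lemma w_bound {N : ℕ} (hN : 2 ≤ N) {m T : ℝ} (hm0 : 0 < m) {u : ℝ → ℝ → ℝ}
    (hu : IsRadialEnergySolution N m T u) {a : ℝ} (ha : a ∈ Ioo 0 T) :
    ∃ C > 0, ∀ r > 0, ∀ t ∈ Icc a T, u r t ^ m ≤ C * gg N r ^ ((1:ℝ)/2) := by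
  obtain ⟨C, hC⟩ := hu.energy_bdd a ha
  refine ⟨Real.sqrt (max C 1), Real.sqrt_pos.2 (lt_max_of_lt_right one_pos), fun r hr t ht => ?_⟩
  have hg := gg_pos hN hr
  rcases eq_or_lt_of_le ht.2 with h | h
  · rw [h, hu.extinction r (le_of_lt hr), Real.zero_rpow hm0.ne']
    positivity
  · have h1 := h1_decay hN (hu.energy t ⟨ha.1.trans_le ht.1, h⟩) hr
    have h2 := hC t ⟨ht.1, h⟩
    rw [← Real.sqrt_eq_rpow, ← Real.sqrt_mul (by positivity)]
    apply Real.le_sqrt_of_sq_le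
    calc _ ≤ _ := h1
      _ ≤ gg N r * max C 1 := mul_le_mul_of_nonneg_left (h2.trans (le_max_left _ _)) hg.le
      _ = _ := mul_comm _ _

lemma gg_tendsto {N : ℕ} (hN : 2 ≤ N) : Tendsto (gg N) atTop (𝓝 0) := by
  obtain ⟨C, hC, h⟩ := gg_ub hN one_pos
  have hN' : (2:ℝ) ≤ N := by exact_mod_cast hN
  have h1 : Tendsto (fun r : ℝ => C * Real.exp (-((N:ℝ)-1) * r)) atTop (𝓝 (C * 0)) := by
    apply Tendsto.const_mul
    apply Real.tendsto_exp_atBot.comp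
    exact tendsto_id.const_mul_atTop_of_neg (by linarith)
  rw [mul_zero] at h1
  refine tendsto_of_tendsto_of_tendsto_of_le_of_le' tendsto_const_nhds h1 ?_ ?_
  · filter_upwards [eventually_gt_atTop 0] with r hr using (gg_pos hN hr).le
  · filter_upwards [eventually_ge_atTop 1] with r hr using h r hr

lemma w_cont {N : ℕ} {m T : ℝ} (hm0 : 0 < m) {u : ℝ → ℝ → ℝ}
    (hu : IsRadialEnergySolution N m T u) :
    ContinuousOn (fun p : ℝ × ℝ => u p.1 p.2 ^ m) (Ici 0 ×ˢ Icc 0 T) :=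
  hu.continuousOn.rpow_const (fun _ _ => Or.inr hm0.le)

lemma bc {N : ℕ} (hN : 2 ≤ N) {m T : ℝ} (hm0 : 0 < m) (hm1 : m < 1) {u : ℝ → ℝ → ℝ}
    (hu : IsRadialEnergySolution N m T u) {a : ℝ} (ha : a ∈ Ioo 0 T) :
    ∀ x ≥ 0, ∀ t s, a < t → t ≤ s → s ≤ T →
      ((t - a) ^ (m/(1-m)) / (s - a) ^ (m/(1-m))) * u x s ^ m ≤ u x t ^ m := by
  set κ := m/(1-m) with hκ
  have h1m : 0 < 1 - m := by linarith
  have hκ0 : 0 < κ := div_pos hm0 h1m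
  by_contra hcon
  push Not at hcon
  obtain ⟨x0, hx0, t0, s0, hat0, hts0, hsT0, hlt⟩ := hcon
  set Φ : ℝ × ℝ × ℝ → ℝ := fun q => ((q.2.1 - a) ^ κ / (q.2.2 - a) ^ κ) * u q.1 q.2.2 ^ m - u q.1 q.2.1 ^ m with hΦ
  set δ := Φ (x0, t0, s0) with hδ
  have hδ0 : 0 < δ := by simp only [hδ, hΦ]; linarith
  have hwn : ∀ x ≥ 0, ∀ t ∈ Icc a T, 0 ≤ u x t ^ m := fun x hx t ht =>
    Real.rpow_nonneg (hu.nonneg x hx t ⟨ha.1.le.trans ht.1, ht.2⟩) _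
  -- ratio at most one
  have hratio : ∀ t s, a ≤ t → t ≤ s → (t - a) ^ κ / (s - a) ^ κ ≤ 1 := fun t s h1 h2 =>
    div_le_one_of_le₀ (Real.rpow_le_rpow (by linarith) (by linarith) hκ0.le)
      (Real.rpow_nonneg (by linarith) _)
  have hΦle : ∀ x ≥ 0, ∀ t s, a ≤ t → t ≤ s → s ≤ T → Φ (x,t,s) ≤ u x s ^ m - u x t ^ m := by
    intro x hx t s h1 h2 h3
    have := mul_le_mul_of_nonneg_right (hratio t s h1 h2) (hwn x hx s ⟨h1.trans h2, h3⟩)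
    simp only [hΦ]; linarith
  -- decay
  obtain ⟨R, hR1, hR⟩ : ∃ R > 0, ∀ x ≥ R, ∀ s ∈ Icc a T, u x s ^ m < δ := by
    obtain ⟨C, hC, hb⟩ := w_bound hN hm0 hu ha
    have ht : Tendsto (fun r => C * gg N r ^ ((1:ℝ)/2)) atTop (𝓝 (C * 0 ^ ((1:ℝ)/2))) :=
      ((gg_tendsto hN).rpow_const (Or.inr (by norm_num))).const_mul C
    rw [Real.zero_rpow (by norm_num), mul_zero] at ht
    obtain ⟨R, hR⟩ := eventually_atTop.1 ((tendsto_order.1 ht).2 δ hδ0)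
    refine ⟨max R 1, lt_max_of_lt_right one_pos, fun x hx s hs => ?_⟩
    exact (hb x (lt_of_lt_of_le one_pos ((le_max_right _ _).trans hx)) s hs).trans_lt
      (hR x ((le_max_left _ _).trans hx))
  set Q : Set (ℝ × ℝ × ℝ) := Icc 0 R ×ˢ Icc a T ×ˢ Icc a T with hQ
  have hQc : IsCompact Q := isCompact_Icc.prod (isCompact_Icc.prod isCompact_Icc)
  have hwc := w_cont hm0 hu
  have hc1 : ContinuousOn (fun q : ℝ × ℝ × ℝ => u q.1 q.2.2 ^ m) Q :=
    hwc.comp (f := fun q : ℝ × ℝ × ℝ => (q.1, q.2.2)) (by fun_prop)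
      (fun q hq => ⟨hq.1.1, ha.1.le.trans hq.2.2.1, hq.2.2.2⟩)
  have hc2 : ContinuousOn (fun q : ℝ × ℝ × ℝ => u q.1 q.2.1 ^ m) Q :=
    hwc.comp (f := fun q : ℝ × ℝ × ℝ => (q.1, q.2.1)) (by fun_prop)
      (fun q hq => ⟨hq.1.1, ha.1.le.trans hq.2.1.1, hq.2.1.2⟩)
  set K : Set (ℝ × ℝ × ℝ) := Q ∩ (fun q : ℝ × ℝ × ℝ => (q.2.2 - q.2.1, u q.1 q.2.2 ^ m - u q.1 q.2.1 ^ m)) ⁻¹' (Ici 0 ×ˢ Ici δ) with hK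
  have hKcl : IsClosed K := by
    refine ContinuousOn.preimage_isClosed_of_isClosed ?_ hQc.isClosed (isClosed_Ici.prod isClosed_Ici)
    exact ContinuousOn.prodMk (by fun_prop) (hc1.sub hc2)
  have hKc : IsCompact K := hQc.of_isClosed_subset hKcl inter_subset_left
  have hKlt : ∀ q ∈ K, q.2.1 < q.2.2 := by
    rintro ⟨x, t, s⟩ ⟨_, hq1, hq2⟩
    simp only [mem_Ici] at hq1 hq2
    rcases eq_or_lt_of_le (sub_nonneg.1 hq1) with h | h
    · rw [h] at hq2; linarith
    · exact h
  have hΦc : ContinuousOn Φ K := by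
    refine ContinuousOn.sub (ContinuousOn.mul (ContinuousOn.div ?_ ?_ ?_) (hc1.mono inter_subset_left)) (hc2.mono inter_subset_left)
    · exact (Continuous.rpow_const (by fun_prop) (fun _ => Or.inr hκ0.le)).continuousOn
    · exact (Continuous.rpow_const (by fun_prop) (fun _ => Or.inr hκ0.le)).continuousOn
    · intro q hq
      have := hKlt q hq
      have h2 := hq.1.2.1.1
      exact (Real.rpow_pos_of_pos (by linarith) _).ne'
  have hq0 : (x0, t0, s0) ∈ K := by
    have h1 := hΦle x0 hx0 t0 s0 hat0.le hts0 hsT0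
    have hs0 : s0 ∈ Icc a T := ⟨hat0.le.trans hts0, hsT0⟩
    have ht0 : t0 ∈ Icc a T := ⟨hat0.le, hts0.trans hsT0⟩
    refine ⟨⟨⟨hx0, ?_⟩, ht0, hs0⟩, ?_, ?_⟩
    · by_contra hh
      push Not at hh
      have := hR x0 hh.le s0 hs0
      have := hwn x0 hx0 t0 ht0
      linarith
    · simp only [mem_Ici]; linarith
    · exact h1
  obtain ⟨⟨x, t, s⟩, hqK, hmax⟩ := hKc.exists_isMaxOn ⟨_, hq0⟩ hΦc
  set M := Φ (x, t, s) with hM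
  have hMδ : δ ≤ M := hmax hq0
  have hglob : ∀ y ≥ 0, ∀ t' s', a ≤ t' → t' ≤ s' → s' ≤ T → Φ (y, t', s') ≤ M := by
    intro y hy t' s' h1 h2 h3
    by_cases hk : (y, t', s') ∈ K
    · exact hmax hk
    · have h4 := hΦle y hy t' s' h1 h2 h3
      have hs' : s' ∈ Icc a T := ⟨h1.trans h2, h3⟩
      have ht' : t' ∈ Icc a T := ⟨h1, h2.trans h3⟩
      rcases le_or_gt y R with h5 | h5
      · by_contra h6
        apply hk
        refine ⟨⟨⟨hy, h5⟩, ht', hs'⟩, ?_, ?_⟩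
        · simp only [mem_Ici]; linarith
        · simp only [mem_Ici]; linarith
      · have := hR y h5.le s' hs'
        have := hwn y hy t' ht'
        linarith
  have hts : t < s := hKlt _ hqK
  have hx : 0 ≤ x := hqK.1.1.1
  have hat : a < t := by
    rcases eq_or_lt_of_le hqK.1.2.1.1 with h | h
    · exfalso
      simp only at h
      have : M = - u x t ^ m := by
        simp only [hM, hΦ]; rw [← h, sub_self, Real.zero_rpow hκ0.ne']; ring
      have := hwn x hx t ⟨h.le, hqK.1.2.1.2⟩
      linarith
    · exact h
  have hsT : s < T := by
    rcases eq_or_lt_of_le hqK.1.2.2.2 with h | h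
    · exfalso
      simp only at h
      have : M = - u x t ^ m := by
        simp only [hM, hΦ]; rw [h, hu.extinction x hx, Real.zero_rpow hm0.ne']; ring
      have := hwn x hx t ⟨hat.le, hqK.1.2.1.2⟩
      linarith
    · exact h
  obtain ⟨Dt, Wr, cDt, cWr, dt, dw, hflux⟩ := pde_reg hN hu
  have htI : t ∈ Ioo 0 T := ⟨ha.1.trans hat, hts.trans hsT⟩
  have hsI : s ∈ Ioo 0 T := ⟨htI.1.trans hts, hsT⟩
  have hu0 := hu.pos x hx t htI
  have hu1 := hu.pos x hx s hsI
  have hta : 0 < t - a := by linarith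
  have hsa : 0 < s - a := by linarith
  set c := (t - a) ^ κ / (s - a) ^ κ with hc
  have hρt : 0 < (t-a)^κ := Real.rpow_pos_of_pos hta _
  have hρs : 0 < (s-a)^κ := Real.rpow_pos_of_pos hsa _
  have hcpos : 0 < c := div_pos hρt hρs
  have hMeq : M = c * u x s ^ m - u x t ^ m := rfl
  -- derivative of w in time
  have dwt : ∀ τ ∈ Ioo 0 T, HasDerivAt (fun τ => u x τ ^ m) (Dt x τ * m * u x τ ^ (m-1)) τ := fun τ hτ =>
    (dt x hx τ hτ).rpow_const (Or.inl (hu.pos x hx τ hτ).ne')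
  have dρ : ∀ τ, a < τ → HasDerivAt (fun τ => (τ - a)^κ) (1 * κ * (τ - a)^(κ-1)) τ := fun τ hτ =>
    ((hasDerivAt_id τ).sub_const a).rpow_const (Or.inl (by simp only [id]; linarith))
  have es : (t-a)^κ * (Dt x s * m * u x s ^ (m-1)) - (1 * κ * (s-a)^(κ-1)) * (c * u x s ^ m) = 0 := by
    have hd := ((dwt s hsI).const_mul ((t-a)^κ)).sub ((dρ s (by linarith)).mul_const (c * u x s ^ m))
    refine IsLocalMax.hasDerivAt_eq_zero (f := (fun τ => (t-a)^κ * u x τ ^ m) - fun τ => (τ - a)^κ * (c * u x s ^ m)) ?_ hd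
    filter_upwards [Ioo_mem_nhds hts hsT] with τ hτ
    have h1 := hglob x hx t τ hat.le hτ.1.le hτ.2.le
    simp only [hΦ] at h1
    have h2 : 0 < (τ - a)^κ := Real.rpow_pos_of_pos (by linarith [hτ.1]) _
    have h3 : (t-a)^κ / (τ-a)^κ * u x τ ^ m ≤ c * u x s ^ m := by linarith
    rw [div_mul_eq_mul_div, div_le_iff₀ h2] at h3
    have h4 : (t-a)^κ * u x s ^ m = (s-a)^κ * (c * u x s ^ m) := by
      rw [hc]; field_simp
    simp only [Pi.sub_apply]
    linarith
  have et : (1 * κ * (t-a)^(κ-1)) * (u x s ^ m / (s-a)^κ) - Dt x t * m * u x t ^ (m-1) = 0 := by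
    have hd := ((dρ t hat).mul_const (u x s ^ m / (s-a)^κ)).sub (dwt t htI)
    refine IsLocalMax.hasDerivAt_eq_zero (f := (fun τ => (τ - a)^κ * (u x s ^ m / (s-a)^κ)) - fun τ => u x τ ^ m) ?_ hd
    filter_upwards [Ioo_mem_nhds hat hts] with τ hτ
    have h1 := hglob x hx τ s hτ.1.le hτ.2.le hsT.le
    simp only [hΦ] at h1
    rw [hMeq, hc] at h1
    simp only [Pi.sub_apply]
    calc _ = _ := by ring
      _ ≤ _ := h1
      _ = _ := by ring
  have em1 : ∀ {y : ℝ}, 0 < y → y ^ (m-1) = y^m / y := fun hy => Real.rpow_sub_one hy.ne' m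
  have em2 : (s-a)^(κ-1) = (s-a)^κ/(s-a) := Real.rpow_sub_one hsa.ne' κ
  have em3 : (t-a)^(κ-1) = (t-a)^κ/(t-a) := Real.rpow_sub_one hta.ne' κ
  have hw1 : 0 < u x s ^ m := Real.rpow_pos_of_pos hu1 _
  have hw0 : 0 < u x t ^ m := Real.rpow_pos_of_pos hu0 _
  have hκm : κ*(1-m) = m := by
    have : 1 - m ≠ 0 := by linarith
    rw [hκ]; field_simp
  have es' : Dt x s = u x s / ((1-m) * (s-a)) := by
    rw [em1 hu1, em2, hc] at es
    field_simp at es ⊢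
    have hta' : 0 < (t-a)^κ := Real.rpow_pos_of_pos hta _
    have e : Dt x s*m*(s-a) - u x s*κ = 0 := by
      refine mul_left_cancel₀ (mul_pos hta' hw1).ne' ?_
      linear_combination es
    refine mul_left_cancel₀ hm0.ne' ?_
    linear_combination (1-m)*e + u x s*hκm
  have et' : Dt x t = u x t / u x t ^ m * (c * u x s ^ m) / ((1-m) * (t-a)) := by
    rw [em1 hu0, em3] at et
    rw [hc]
    field_simp at et ⊢
    refine mul_left_cancel₀ hm0.ne' ?_
    linear_combination -(1-m)*et + (t-a)^κ*u x s^m*u x t*hκm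
  have hstrict : u x t / u x t ^ m < (t-a)/(s-a) * (u x s / u x s ^ m) := by
    have h1 : u x t ^ m < c * u x s ^ m := by linarith
    have h2 := Real.rpow_lt_rpow hw0.le h1 (show 0 < (1-m)/m by positivity)
    rw [Real.mul_rpow hcpos.le hw1.le, ← Real.rpow_mul hu0.le, ← Real.rpow_mul hu1.le, hc,
      ← Real.div_rpow hta.le hsa.le, ← Real.rpow_mul (by positivity), mul_div_cancel₀ _ hm0.ne',
      show κ * ((1-m)/m) = 1 by rw [hκ]; field_simp, Real.rpow_one, Real.rpow_sub hu0, Real.rpow_sub hu1,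
      Real.rpow_one, Real.rpow_one] at h2
    exact h2
  have hHpos : 0 < c * Dt x s - Dt x t := by
    rw [es', et']
    have h1 : u x t / u x t ^ m * (c * u x s ^ m) / ((1-m) * (t-a)) <
        ((t-a)/(s-a) * (u x s / u x s ^ m)) * (c * u x s ^ m) / ((1-m) * (t-a)) := by gcongr
    have h2 : ((t-a)/(s-a) * (u x s / u x s ^ m)) * (c * u x s ^ m) / ((1-m) * (t-a)) = c * (u x s / ((1-m) * (s-a))) := by
      field_simp
    linarith
  -- space part
  have slice : ∀ {h : ℝ → ℝ → ℝ}, ContinuousOn (Function.uncurry h) (Ici 0 ×ˢ Ioo 0 T) → ∀ τ ∈ Ioo 0 T, ContinuousOn (fun y => h y τ) (Ici 0) := by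
    intro h hh τ hτ
    exact hh.comp (f := fun s => (s, τ)) (by fun_prop) (fun s hs => ⟨hs, hτ⟩)
  have cH : ContinuousOn (fun y => c * Dt y s - Dt y t) (Ici 0) :=
    (continuousOn_const.mul (slice cDt s hsI)).sub (slice cDt t htI)
  obtain ⟨η, hη, hηpos⟩ : ∃ η > 0, ∀ y ∈ Icc x (x+η), 0 < c * Dt y s - Dt y t := by
    have h1 : ∀ᶠ y in 𝓝[Ici 0] x, 0 < c * Dt y s - Dt y t := (cH x hx).eventually (lt_mem_nhds hHpos)
    rw [eventually_nhdsWithin_iff, Metric.eventually_nhds_iff] at h1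
    obtain ⟨e, he, h⟩ := h1
    refine ⟨e/2, by linarith, fun y hy => h ?_ (hx.trans hy.1)⟩
    rw [Real.dist_eq, abs_of_nonneg (by linarith [hy.1])]; linarith [hy.2]
  have cwH : ContinuousOn (fun y => wt N y * (c * Dt y s - Dt y t)) (Ici 0) := (wt_cont N).continuousOn.mul cH
  have iiH : ∀ y ≥ 0, ∀ z ≥ 0, IntervalIntegrable (fun y => wt N y * (c * Dt y s - Dt y t)) volume y z := fun y hy z hz =>
    (cwH.mono (fun q hq => (le_min hy hz).trans hq.1)).intervalIntegrable
  have hFl : ∀ y ≥ 0, wt N y * (c * Wr y s - Wr y t) = ∫ q in (0:ℝ)..y, wt N q * (c * Dt q s - Dt q t) := by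
    intro y hy
    have i1 : IntervalIntegrable (fun q => wt N q * Dt q s) volume 0 y :=
      (((wt_cont N).continuousOn.mul (slice cDt s hsI)).mono (fun q hq => (le_min le_rfl hy).trans hq.1)).intervalIntegrable
    have i2 : IntervalIntegrable (fun q => wt N q * Dt q t) volume 0 y :=
      (((wt_cont N).continuousOn.mul (slice cDt t htI)).mono (fun q hq => (le_min le_rfl hy).trans hq.1)).intervalIntegrable
    calc wt N y * (c * Wr y s - Wr y t) = c * (wt N y * Wr y s) - wt N y * Wr y t := by ring
      _ = c * (∫ q in (0:ℝ)..y, wt N q * Dt q s) - ∫ q in (0:ℝ)..y, wt N q * Dt q t := by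
          rw [hflux y hy s hsI, hflux y hy t htI]
      _ = _ := by
          rw [← intervalIntegral.integral_const_mul, ← intervalIntegral.integral_sub (i1.const_mul c) i2]
          congr 1; ext q; ring
  have dh : ∀ y > 0, HasDerivAt (fun y => c * u y s ^ m - u y t ^ m) (c * Wr y s - Wr y t) y := fun y hy =>
    ((dw y hy s hsI).const_mul c).sub (dw y hy t htI)
  have hFx : wt N x * (c * Wr x s - Wr x t) = 0 := by
    rcases eq_or_lt_of_le hx with h | h
    · rw [← h]; unfold wt; rw [Real.sinh_zero, zero_pow (by omega)]; ring
    · have : c * Wr x s - Wr x t = 0 := by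
        refine IsLocalMax.hasDerivAt_eq_zero ?_ (dh x h)
        filter_upwards [Ioi_mem_nhds h] with y hy
        exact hglob y (le_of_lt hy) t s hat.le hts.le hsT.le
      rw [this, mul_zero]
  have hmono : StrictMonoOn (fun y => c * u y s ^ m - u y t ^ m) (Icc x (x+η)) := by
    apply strictMonoOn_of_deriv_pos (convex_Icc _ _)
    · have k1 : ContinuousOn (fun y => u y s ^ m) (Ici 0) :=
        hwc.comp (f := fun y : ℝ => (y, s)) (by fun_prop) (fun y hy => ⟨hy, hsI.1.le, hsI.2.le⟩)
      have k2 : ContinuousOn (fun y => u y t ^ m) (Ici 0) :=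
        hwc.comp (f := fun y : ℝ => (y, t)) (by fun_prop) (fun y hy => ⟨hy, htI.1.le, htI.2.le⟩)
      exact ((continuousOn_const.mul k1).sub k2).mono (fun y hy => hx.trans hy.1)
    · intro y hy
      rw [interior_Icc] at hy
      have hy0 : 0 < y := hx.trans_lt hy.1
      rw [(dh y hy0).deriv]
      have h1 := hFl y hy0.le
      rw [← intervalIntegral.integral_add_adjacent_intervals (iiH 0 le_rfl x hx) (iiH x hx y hy0.le), ← hFl x hx, hFx, zero_add] at h1
      have h2 : 0 < ∫ q in x..y, wt N q * (c * Dt q s - Dt q t) := by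
        apply intervalIntegral.intervalIntegral_pos_of_pos_on (iiH x hx y hy0.le) _ hy.1
        intro q hq
        exact mul_pos (wt_pos (hx.trans_lt hq.1)) (hηpos q ⟨hq.1.le, hq.2.le.trans hy.2.le⟩)
      rw [← h1] at h2
      exact (pos_iff_pos_of_mul_pos h2).1 (wt_pos hy0)
  have h1 := hmono (left_mem_Icc.2 (by linarith)) (right_mem_Icc.2 (by linarith)) (by linarith : x < x + η)
  have h2 := hglob (x+η) (by linarith) t s hat.le hts.le hsT.le
  simp only [hΦ] at h2
  simp only at h1
  linarith


lemma step1 {N : ℕ} (hN : 2 ≤ N) {m T : ℝ} {u : ℝ → ℝ → ℝ}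
    (hu : IsRadialEnergySolution N m T u) {r R t t' : ℝ} (hr : 0 < r) (hR : r ≤ R)
    (ht : t ∈ Ioo 0 T) (ht' : t' ∈ Ioo 0 T) :
    ∫ ρ in r..R, (wt N ρ)⁻¹ * ((∫ s in (0:ℝ)..ρ, wt N s * u s t') - ∫ s in (0:ℝ)..ρ, wt N s * u s t)
      = ∫ τ in t..t', (u R τ ^ m - u r τ ^ m) := by
  obtain ⟨Dt, Wr, cDt, cWr, hDt, hWr, hfl⟩ := pde_reg hN hu
  have hI : uIcc t t' ⊆ Ioo 0 T := (convex_Ioo _ _).ordConnected.uIcc_subset ht ht'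
  have hI' : uIoc t t' ⊆ Ioo 0 T := uIoc_subset_uIcc.trans hI
  have hu0 : ∀ τ ∈ Ioo 0 T, ContinuousOn (fun s => wt N s * u s τ) (Ici 0) := fun τ hτ =>
    (wt_cont N).continuousOn.mul (hu.smooth.continuousOn.comp (f := fun s => (s, τ)) (by fun_prop) (fun s hs => ⟨hs, hτ⟩))
  -- mass identity
  have hmass : ∀ ρ > 0, ((∫ s in (0:ℝ)..ρ, wt N s * u s t') - ∫ s in (0:ℝ)..ρ, wt N s * u s t)
      = ∫ τ in t..t', wt N ρ * Wr ρ τ := by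
    intro ρ hρ
    have e1 : ∫ τ in t..t', wt N ρ * Wr ρ τ = ∫ τ in t..t', ∫ s in (0:ℝ)..ρ, wt N s * Dt s τ :=
      intervalIntegral.integral_congr (fun τ hτ => hfl ρ hρ.le τ (hI hτ))
    rw [e1, intervalIntegral_intervalIntegral_swap]
    · rw [← intervalIntegral.integral_sub
        ((hu0 t' ht').mono (fun q hq => (le_min le_rfl hρ.le).trans hq.1)).intervalIntegrable
        ((hu0 t ht).mono (fun q hq => (le_min le_rfl hρ.le).trans hq.1)).intervalIntegrable]
      refine intervalIntegral.integral_congr (fun s hs => ?_)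
      have hs0 : 0 ≤ s := (le_min le_rfl hρ.le).trans hs.1
      have := intervalIntegral.integral_eq_sub_of_hasDerivAt (f := fun τ => u s τ) (f' := fun τ => Dt s τ) (a := t) (b := t')
        (fun τ hτ => hDt s hs0 τ (hI hτ))
        ((cDt.comp (f := fun τ => (s, τ)) (by fun_prop) (fun τ hτ => ⟨hs0, hI hτ⟩)).intervalIntegrable)
      simp only [intervalIntegral.integral_const_mul]
      rw [this]; ring
    · refine IntegrableOn.mono_set (t := uIcc t t' ×ˢ uIcc 0 ρ) ?_ (prod_mono uIoc_subset_uIcc uIoc_subset_uIcc)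
      refine ContinuousOn.integrableOn_compact (isCompact_uIcc.prod isCompact_uIcc) ?_
      refine ContinuousOn.mul ((wt_cont N).comp continuous_snd).continuousOn ?_
      exact cDt.comp (f := fun p : ℝ × ℝ => (p.2, p.1)) (by fun_prop) (fun p hp => ⟨(le_min le_rfl hρ.le).trans hp.2.1, hI hp.1⟩)
  have hsub : uIcc r R ⊆ Ioi 0 := fun q hq => lt_of_lt_of_le (lt_min hr (hr.trans_le hR)) hq.1
  have e2 : ∫ ρ in r..R, (wt N ρ)⁻¹ * ((∫ s in (0:ℝ)..ρ, wt N s * u s t') - ∫ s in (0:ℝ)..ρ, wt N s * u s t)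
      = ∫ ρ in r..R, ∫ τ in t..t', Wr ρ τ := by
    refine intervalIntegral.integral_congr (fun ρ hρ => ?_)
    have hρ0 : 0 < ρ := hsub hρ
    rw [hmass ρ hρ0, intervalIntegral.integral_const_mul, ← mul_assoc, inv_mul_cancel₀ (wt_pos hρ0).ne', one_mul]
  rw [e2, intervalIntegral_intervalIntegral_swap]
  · refine intervalIntegral.integral_congr (fun τ hτ => ?_)
    exact intervalIntegral.integral_eq_sub_of_hasDerivAt (f := fun ρ => u ρ τ ^ m) (fun ρ hρ => hWr ρ (hsub hρ) τ (hI hτ))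
        ((cWr.comp (f := fun ρ => (ρ, τ)) (by fun_prop) (fun ρ hρ => ⟨mem_Ici.2 (le_of_lt (mem_Ioi.1 (hsub hρ))), hI hτ⟩)).intervalIntegrable)
  · refine IntegrableOn.mono_set (t := uIcc r R ×ˢ uIcc t t') ?_ (prod_mono uIoc_subset_uIcc uIoc_subset_uIcc)
    refine ContinuousOn.integrableOn_compact (isCompact_uIcc.prod isCompact_uIcc) ?_
    exact cWr.mono (fun p hp => ⟨mem_Ici.2 (le_of_lt (mem_Ioi.1 (hsub hp.1))), hI hp.2⟩)

noncomputable def mm (N : ℕ) (v : ℝ → ℝ → ℝ) (ρ t : ℝ) : ℝ := ∫ s in (0:ℝ)..ρ, wt N s * v s t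

structure Core (N : ℕ) (m a T C : ℝ) (v : ℝ → ℝ → ℝ) : Prop where
  aT : a < T
  hC : 0 < C
  cont : Continuous (Function.uncurry v)
  nn : ∀ r t, 0 ≤ v r t
  ext : ∀ r, v r T = 0
  pos : ∀ r, ∀ t ∈ Ico a T, 0 < v r t
  bd : ∀ r > 0, ∀ t, v r t ^ m ≤ C * gg N r ^ ((1:ℝ)/2)
  bc : ∀ x t s, a ≤ t → t ≤ s → s ≤ T → v x s ^ m ≤ C * v x t ^ m
  rep : ∀ r > 0, ∀ t ∈ Icc a T, IntegrableOn (fun ρ => (wt N ρ)⁻¹ * mm N v ρ t) (Ioi r) ∧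
    ∫ τ in t..T, v r τ ^ m = ∫ ρ in Ioi r, (wt N ρ)⁻¹ * mm N v ρ t

lemma mm_cont {N : ℕ} {v : ℝ → ℝ → ℝ} (hv : Continuous (Function.uncurry v)) :
    Continuous (fun p : ℝ × ℝ => mm N v p.1 p.2) := by
  unfold mm
  refine intervalIntegral.continuous_parametric_intervalIntegral_of_continuous
    (f := fun (p : ℝ × ℝ) s => wt N s * v s p.2) ?_ continuous_fst
  refine ((wt_cont N).comp continuous_snd).mul ?_
  exact hv.comp (f := fun q : (ℝ × ℝ) × ℝ => (q.2, q.1.2)) (by fun_prop)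

lemma core_exists {N : ℕ} (hN : 2 ≤ N) {m T : ℝ} (hm0 : 0 < m) (hm1 : m < 1) {u : ℝ → ℝ → ℝ}
    (hu : IsRadialEnergySolution N m T u) {a : ℝ} (ha : a ∈ Ioo 0 T) :
    ∃ C v, Core N m a T C v ∧ ∀ r ≥ 0, ∀ t ∈ Icc a T, v r t = u r t := by
  have ha2 : a/2 ∈ Ioo 0 T := ⟨by linarith [ha.1], by linarith [ha.1, ha.2]⟩
  obtain ⟨C1, hC1, hb⟩ := w_bound hN hm0 hu ha
  have hbc := bc hN hm0 hm1 hu ha2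
  set C2 := ((T - a/2) ^ (m/(1-m)) / (a - a/2) ^ (m/(1-m))) with hC2
  have hT0 : 0 < T := ha.1.trans ha.2
  set v : ℝ → ℝ → ℝ := fun r t => u (max r 0) (max a (min t T)) with hv
  have hmem : ∀ t, max a (min t T) ∈ Icc a T := fun t => ⟨le_max_left _ _, max_le ha.2.le (min_le_right _ _)⟩
  have hmem0 : ∀ t, max a (min t T) ∈ Icc 0 T := fun t => ⟨ha.1.le.trans (hmem t).1, (hmem t).2⟩
  have hid : ∀ t ∈ Icc a T, max a (min t T) = t := fun t ht => by rw [min_eq_left ht.2, max_eq_right ht.1]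
  have hvu : ∀ r ≥ 0, ∀ t ∈ Icc a T, v r t = u r t := by
    intro r hr t ht
    simp only [hv]
    rw [hid t ht, max_eq_left hr]
  have cv : Continuous (Function.uncurry v) := by
    refine hu.continuousOn.comp_continuous (f := fun p : ℝ × ℝ => (max p.1 0, max a (min p.2 T))) (by fun_prop) ?_
    exact fun p => ⟨mem_Ici.2 (le_max_right _ _), hmem0 _⟩
  have nn : ∀ r t, 0 ≤ v r t := fun r t => hu.nonneg _ (mem_Ici.2 (le_max_right _ _)) _ (hmem0 t)
  have ext : ∀ r, v r T = 0 := fun r => by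
    simp only [hv]
    rw [hid T ⟨ha.2.le, le_rfl⟩]
    exact hu.extinction _ (mem_Ici.2 (le_max_right _ _))
  have bd : ∀ r > 0, ∀ t, v r t ^ m ≤ C1 * gg N r ^ ((1:ℝ)/2) := fun r hr t => by
    simp only [hv]
    rw [max_eq_left hr.le]
    exact hb r hr _ (hmem t)
  have hC2pos : 0 < C2 := div_pos (Real.rpow_pos_of_pos (by linarith [ha.1, ha.2]) _) (Real.rpow_pos_of_pos (by linarith [ha.1, ha.2]) _)
  have cmm := mm_cont (N := N) cv
  have cw : Continuous (fun p : ℝ × ℝ => v p.1 p.2 ^ m) := Continuous.rpow_const cv (fun _ => Or.inr hm0.le)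
  have mm0 : ∀ ρ ≥ 0, ∀ t, 0 ≤ mm N v ρ t := fun ρ hρ t =>
    intervalIntegral.integral_nonneg hρ (fun s hs => mul_nonneg (wt_nonneg hs.1) (nn s t))
  have mmT : ∀ ρ, mm N v ρ T = 0 := fun ρ => by simp [mm, ext]
  -- step on [t,T]
  have hstep : ∀ r > 0, ∀ R ≥ r, ∀ t ∈ Ico a T, ∫ ρ in r..R, (wt N ρ)⁻¹ * mm N v ρ t = ∫ τ in t..T, (v r τ ^ m - v R τ ^ m) := by
    intro r hr R hR t ht
    have hsub : uIcc r R ⊆ Ici r := fun q hq => (le_min le_rfl hR).trans hq.1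
    have c1 : Continuous (fun t' => ∫ ρ in r..R, (wt N (max r ρ))⁻¹ * (mm N v ρ t' - mm N v ρ t)) := by
      refine intervalIntegral.continuous_parametric_intervalIntegral_of_continuous' (f := fun t' ρ => (wt N (max r ρ))⁻¹ * (mm N v ρ t' - mm N v ρ t)) ?_ r R
      refine Continuous.mul ?_ ?_
      · refine Continuous.inv₀ ((wt_cont N).comp (by fun_prop)) (fun p => (wt_pos (lt_of_lt_of_le hr (le_max_left _ _))).ne')
      · exact (cmm.comp (f := fun p : ℝ × ℝ => (p.2, p.1)) (by fun_prop)).sub (cmm.comp (f := fun p : ℝ × ℝ => (p.2, t)) (by fun_prop))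
    have cvr : ∀ q, Continuous (fun τ => v q τ ^ m) := fun q => cw.comp (f := fun τ => (q, τ)) (by fun_prop)
    have c2 : Continuous (fun t' => ∫ τ in t..t', (v R τ ^ m - v r τ ^ m)) :=
      intervalIntegral.continuous_primitive (fun a b => ((cvr R).sub (cvr r)).intervalIntegrable a b) t
    have heq : EqOn (fun t' => ∫ ρ in r..R, (wt N (max r ρ))⁻¹ * (mm N v ρ t' - mm N v ρ t))
        (fun t' => ∫ τ in t..t', (v R τ ^ m - v r τ ^ m)) (Ico t T) := by
      intro t' ht'
      have h := step1 hN hu hr hR (t := t) (t' := t') ⟨ha.1.trans_le ht.1, ht.2⟩ ⟨(ha.1.trans_le ht.1).trans_le ht'.1, ht'.2⟩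
      have hmu : ∀ ρ ≥ r, ∀ τ ∈ Icc a T, mm N v ρ τ = ∫ s in (0:ℝ)..ρ, wt N s * u s τ := by
        intro ρ hρ τ hτ
        refine intervalIntegral.integral_congr (fun s hs => ?_)
        rw [hvu s ((le_min le_rfl (hr.le.trans hρ)).trans hs.1) τ hτ]
      have l : ∫ ρ in r..R, (wt N (max r ρ))⁻¹ * (mm N v ρ t' - mm N v ρ t) =
        ∫ ρ in r..R, (wt N ρ)⁻¹ * ((∫ s in (0:ℝ)..ρ, wt N s * u s t') - ∫ s in (0:ℝ)..ρ, wt N s * u s t) := by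
        refine intervalIntegral.integral_congr (fun ρ hρ => ?_)
        rw [max_eq_right (hsub hρ), hmu ρ (hsub hρ) t ⟨ht.1, ht.2.le⟩, hmu ρ (hsub hρ) t' ⟨ht.1.trans ht'.1, ht'.2.le⟩]
      beta_reduce
      rw [l, h]
      refine intervalIntegral.integral_congr (fun τ hτ => ?_)
      rw [uIcc_of_le ht'.1] at hτ
      have hτ' : τ ∈ Icc a T := ⟨ht.1.trans hτ.1, hτ.2.trans ht'.2.le⟩
      rw [hvu R (hr.le.trans hR) τ hτ', hvu r hr.le τ hτ']
    have hT := (heq.closure c1 c2) (show T ∈ closure (Ico t T) by rw [closure_Ico ht.2.ne]; exact ⟨ht.2.le, le_rfl⟩)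
    simp only [mmT] at hT
    have l : ∫ ρ in r..R, (wt N ρ)⁻¹ * mm N v ρ t = - ∫ ρ in r..R, (wt N (max r ρ))⁻¹ * (0 - mm N v ρ t) := by
      rw [← intervalIntegral.integral_neg]
      refine intervalIntegral.integral_congr (fun ρ hρ => ?_)
      rw [max_eq_right (hsub hρ)]; ring
    rw [l, hT, ← intervalIntegral.integral_neg]
    refine intervalIntegral.integral_congr (fun ρ hρ => ?_)
    ring
  refine ⟨max C1 C2, v, ⟨ha.2, lt_max_of_lt_left hC1, cv, nn, ext, ?_, ?_, ?_, ?_⟩, hvu⟩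
  · intro r t ht
    simp only [hv]
    rw [hid t ⟨ht.1, ht.2.le⟩]
    exact hu.pos _ (mem_Ici.2 (le_max_right _ _)) _ ⟨ha.1.trans_le ht.1, ht.2⟩
  · intro r hr t
    refine (bd r hr t).trans ?_
    have := (gg_pos hN hr).le
    gcongr
    exact le_max_left _ _
  · intro x t s hat hts hsT
    have h := hbc (max x 0) (le_max_right _ _) t s (by linarith [ha.1]) hts hsT
    simp only [hv]
    rw [hid t ⟨hat, hts.trans hsT⟩, hid s ⟨hat.trans hts, hsT⟩]
    have p1 : 0 < (t - a/2)^(m/(1-m)) := Real.rpow_pos_of_pos (by linarith [ha.1]) _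
    have p2 : 0 < (s - a/2)^(m/(1-m)) := Real.rpow_pos_of_pos (by linarith [ha.1]) _
    have p3 : (s - a/2)^(m/(1-m)) / (t - a/2)^(m/(1-m)) ≤ C2 := by
      rw [hC2]
      have : 0 ≤ m/(1-m) := div_nonneg hm0.le (by linarith)
      have q1 : (0:ℝ) ≤ s - a/2 := by linarith [ha.1]
      have q2 : (0:ℝ) < a - a/2 := by linarith [ha.1]
      have q4 : 0 ≤ (T - a/2)^(m/(1-m)) := Real.rpow_nonneg (by linarith [ha.1, ha.2]) _
      have q3 : 0 < (a - a/2)^(m/(1-m)) := Real.rpow_pos_of_pos q2 _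
      gcongr
    have hn : 0 ≤ u (max x 0) t ^ m := Real.rpow_nonneg (hu.nonneg _ (mem_Ici.2 (le_max_right _ _)) _ ⟨ha.1.le.trans hat, hts.trans hsT⟩) _
    calc u (max x 0) s ^ m = (s - a/2)^(m/(1-m)) / (t - a/2)^(m/(1-m)) * ((t - a/2)^(m/(1-m)) / (s - a/2)^(m/(1-m)) * u (max x 0) s ^ m) := by
          generalize (s - a/2)^(m/(1-m)) = X at *
          generalize (t - a/2)^(m/(1-m)) = Y at *
          field_simp
      _ ≤ (s - a/2)^(m/(1-m)) / (t - a/2)^(m/(1-m)) * u (max x 0) t ^ m := by gcongr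
      _ ≤ _ := by gcongr; exact p3.trans (le_max_right _ _)
  · intro r hr t ht
    rcases ht.2.eq_or_lt with rfl | htT
    · simp [mmT]
    have ht2 : t ∈ Ico a T := ⟨ht.1, htT⟩
    have cvr : ∀ q, Continuous (fun τ => v q τ ^ m) := fun q => cw.comp (f := fun τ => (q, τ)) (by fun_prop)
    have cint : ContinuousOn (fun ρ => (wt N ρ)⁻¹ * mm N v ρ t) (Ioi 0) :=
      (wtinv_cont N).mul (cmm.comp (f := fun ρ => (ρ, t)) (by fun_prop)).continuousOn
    have hint : IntegrableOn (fun ρ => (wt N ρ)⁻¹ * mm N v ρ t) (Ioi r) := by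
      refine integrableOn_Ioi_of_intervalIntegral_norm_bounded (∫ τ in t..T, v r τ ^ m) r (b := fun R : ℝ => R) (l := atTop) ?_ tendsto_id ?_
      · intro R
        exact ((cint.mono (fun q hq => hr.trans_le hq.1)).integrableOn_compact isCompact_Icc).mono_set Ioc_subset_Icc_self
      · filter_upwards [eventually_ge_atTop r] with R hR
        have : ∫ ρ in r..R, ‖(wt N ρ)⁻¹ * mm N v ρ t‖ = ∫ ρ in r..R, (wt N ρ)⁻¹ * mm N v ρ t := by
          refine intervalIntegral.integral_congr (fun ρ hρ => ?_)
          rw [uIcc_of_le hR] at hρ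
          exact Real.norm_of_nonneg (mul_nonneg (inv_nonneg.2 (wt_pos (hr.trans_le hρ.1)).le) (mm0 ρ (hr.le.trans hρ.1) t))
        rw [this, hstep r hr R hR t ht2]
        refine intervalIntegral.integral_mono_on htT.le ((cvr r).sub (cvr R) |>.intervalIntegrable _ _) ((cvr r).intervalIntegrable _ _) ?_
        intro τ _
        linarith [Real.rpow_nonneg (nn R τ) m]
    refine ⟨hint, ?_⟩
    have l1 := intervalIntegral_tendsto_integral_Ioi r hint (b := fun R : ℝ => R) (l := atTop) tendsto_id
    have l2 : Tendsto (fun R => ∫ τ in t..T, (v r τ ^ m - v R τ ^ m)) atTop (𝓝 (∫ τ in t..T, v r τ ^ m)) := by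
      have l3 : Tendsto (fun R => ∫ τ in t..T, v R τ ^ m) atTop (𝓝 0) := by
        have g0 : Tendsto (fun R => (T-t) * (C1 * gg N R ^ ((1:ℝ)/2))) atTop (𝓝 0) := by
          have := ((gg_tendsto hN).rpow_const (p := (1:ℝ)/2) (Or.inr (by norm_num))).const_mul C1 |>.const_mul (T-t)
          simpa using this
        refine squeeze_zero' (Eventually.of_forall fun R => intervalIntegral.integral_nonneg htT.le (fun τ _ => Real.rpow_nonneg (nn R τ) m)) ?_ g0
        filter_upwards [eventually_gt_atTop 0] with R hR
        have := intervalIntegral.integral_mono_on (μ := volume) htT.le ((cvr R).intervalIntegrable _ _) (continuous_const (y := C1 * gg N R ^ ((1:ℝ)/2)) |>.intervalIntegrable _ _) (fun τ _ => bd R hR τ)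
        rwa [intervalIntegral.integral_const, smul_eq_mul] at this
      have : (fun R => ∫ τ in t..T, (v r τ ^ m - v R τ ^ m)) = fun R => (∫ τ in t..T, v r τ ^ m) - ∫ τ in t..T, v R τ ^ m := by
        funext R
        exact intervalIntegral.integral_sub ((cvr r).intervalIntegrable _ _) ((cvr R).intervalIntegrable _ _)
      rw [this]
      simpa using l3.const_sub (∫ τ in t..T, v r τ ^ m)
    refine tendsto_nhds_unique l2 (l1.congr' ?_)
    filter_upwards [eventually_ge_atTop r] with R hR
    exact hstep r hr R hR t ht2


noncomputable def UU (m T : ℝ) (v : ℝ → ℝ → ℝ) (r t : ℝ) : ℝ := ∫ τ in t..T, v r τ ^ m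
noncomputable def BB (N : ℕ) (m : ℝ) (v : ℝ → ℝ → ℝ) (s t : ℝ) : ℝ :=
  ∫ r in Ioi (0:ℝ), v r s * v r t ^ m * wt N r
noncomputable def AA (N : ℕ) (m T : ℝ) (v : ℝ → ℝ → ℝ) (s t : ℝ) : ℝ :=
  ∫ r in Ioi (0:ℝ), v r s * UU m T v r t * wt N r

lemma wcont {m : ℝ} (hm0 : 0 < m) {v : ℝ → ℝ → ℝ} (h : Continuous (Function.uncurry v)) :
    Continuous (fun p : ℝ × ℝ => v p.1 p.2 ^ m) :=
  Continuous.rpow_const h (fun _ => Or.inr hm0.le)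

lemma slice_w {m : ℝ} (hm0 : 0 < m) {v : ℝ → ℝ → ℝ} (h : Continuous (Function.uncurry v)) (r : ℝ) :
    Continuous (fun τ => v r τ ^ m) := (wcont hm0 h).comp (f := fun τ => (r, τ)) (by fun_prop)

lemma UU_cont {m T : ℝ} (hm0 : 0 < m) {v : ℝ → ℝ → ℝ} (h : Continuous (Function.uncurry v)) (t : ℝ) :
    Continuous (fun r => UU m T v r t) :=
  intervalIntegral.continuous_parametric_intervalIntegral_of_continuous' (f := fun r τ => v r τ ^ m) (wcont hm0 h) t T

section
variable {N : ℕ} {m a T C : ℝ} {v : ℝ → ℝ → ℝ}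

lemma UU_nn (hc : Core N m a T C v) {t : ℝ} (ht : t ≤ T) (r : ℝ) : 0 ≤ UU m T v r t :=
  intervalIntegral.integral_nonneg ht (fun τ _ => Real.rpow_nonneg (hc.nn r τ) m)

lemma mm_nn (hc : Core N m a T C v) {ρ : ℝ} (hρ : 0 ≤ ρ) (t : ℝ) : 0 ≤ mm N v ρ t :=
  intervalIntegral.integral_nonneg hρ (fun s hs => mul_nonneg (wt_nonneg hs.1) (hc.nn s t))

lemma mm_mono (hc : Core N m a T C v) {ρ R : ℝ} (hρ : 0 ≤ ρ) (h : ρ ≤ R) (t : ℝ) : mm N v ρ t ≤ mm N v R t := by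
  have cc : Continuous (fun s => wt N s * v s t) := (wt_cont N).mul (hc.cont.comp (f := fun s => (s, t)) (by fun_prop))
  have := intervalIntegral.integral_add_adjacent_intervals (cc.intervalIntegrable (μ := volume) 0 ρ) (cc.intervalIntegrable ρ R)
  have h2 : 0 ≤ ∫ s in ρ..R, wt N s * v s t := intervalIntegral.integral_nonneg h (fun s hs => mul_nonneg (wt_nonneg (hρ.trans hs.1)) (hc.nn s t))
  unfold mm; linarith

lemma UU_anti (hc : Core N m a T C v) {t r R : ℝ} (ht : t ∈ Icc a T) (hr : 0 < r) (hR : r ≤ R) :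
    UU m T v R t ≤ UU m T v r t := by
  unfold UU
  rw [(hc.rep r hr t ht).2, (hc.rep R (hr.trans_le hR) t ht).2]
  refine setIntegral_mono_set (hc.rep r hr t ht).1 ?_ (Ioi_subset_Ioi hR).eventuallyLE
  filter_upwards [self_mem_ae_restrict measurableSet_Ioi] with ρ hρ
  exact mul_nonneg (inv_nonneg.2 (wt_pos (hr.trans hρ)).le) (mm_nn hc (hr.trans hρ).le t)

lemma UU_harnack (hN : 2 ≤ N) (hc : Core N m a T C v) {t r R : ℝ} (ht : t ∈ Icc a T) (hr : 0 < r) (hR : r ≤ R) :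
    UU m T v r t * gg N R ≤ UU m T v R t * gg N r := by
  have hR0 : 0 < R := hr.trans_le hR
  obtain ⟨i1, e1⟩ := hc.rep r hr t ht
  obtain ⟨i2, e2⟩ := hc.rep R hR0 t ht
  have h1 : mm N v R t * gg N R ≤ UU m T v R t := by
    unfold UU gg
    rw [e2, ← integral_const_mul]
    refine setIntegral_mono_on ((wtinv_int hN hR0).const_mul _) i2 measurableSet_Ioi (fun ρ hρ => ?_)
    rw [mul_comm]
    exact mul_le_mul_of_nonneg_left (mm_mono hc hR0.le (le_of_lt hρ) t) (inv_nonneg.2 (wt_pos (hR0.trans hρ)).le)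
  have h2 : UU m T v r t - UU m T v R t ≤ mm N v R t * (gg N r - gg N R) := by
    unfold UU
    rw [e1, e2, intervalIntegral.integral_Ioi_sub_Ioi' i1 i2, gg_sub hN hr hR0, ← intervalIntegral.integral_const_mul]
    refine intervalIntegral.integral_mono_on hR ?_ ((wtinv_ii hN hr hR0).const_mul _) (fun ρ hρ => ?_)
    · rw [intervalIntegrable_iff_integrableOn_Ioc_of_le hR]
      exact i1.mono_set Ioc_subset_Ioi_self
    · rw [mul_comm]
      exact mul_le_mul_of_nonneg_right (mm_mono hc (hr.le.trans hρ.1) hρ.2 t) (inv_nonneg.2 (wt_pos (hr.trans_le hρ.1)).le)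
  have g1 := gg_pos hN hR0
  have g2 : gg N R ≤ gg N r := gg_anti hN hr hR0 hR
  have h3 : (UU m T v r t - UU m T v R t) * gg N R ≤ (mm N v R t * gg N R) * (gg N r - gg N R) := by
    calc _ ≤ (mm N v R t * (gg N r - gg N R)) * gg N R := by gcongr
      _ = _ := by ring
  have h4 : (mm N v R t * gg N R) * (gg N r - gg N R) ≤ UU m T v R t * (gg N r - gg N R) :=
    mul_le_mul_of_nonneg_right h1 (by linarith)
  linarith

lemma v_bd (hm0 : 0 < m) (hN : 2 ≤ N) (hc : Core N m a T C v) {r : ℝ} (hr : 0 < r) (s t : ℝ) :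
    v r s * v r t ^ m ≤ C ^ (1 + 1/m) * gg N r ^ ((1+1/m)/2) := by
  have hg := gg_pos hN hr
  have h1 : v r s ≤ (C * gg N r ^ ((1:ℝ)/2)) ^ (1/m) := by
    have := Real.rpow_le_rpow (Real.rpow_nonneg (hc.nn r s) m) (hc.bd r hr s) (show 0 ≤ 1/m by positivity)
    rwa [← Real.rpow_mul (hc.nn r s), mul_one_div_cancel hm0.ne', Real.rpow_one] at this
  have h2 := hc.bd r hr t
  have hX : 0 < C * gg N r ^ ((1:ℝ)/2) := mul_pos hc.hC (Real.rpow_pos_of_pos hg _)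
  calc _ ≤ (C * gg N r ^ ((1:ℝ)/2)) ^ (1/m) * (C * gg N r ^ ((1:ℝ)/2)) :=
        mul_le_mul h1 h2 (Real.rpow_nonneg (hc.nn r t) m) (Real.rpow_nonneg hX.le _)
    _ = (C * gg N r ^ ((1:ℝ)/2)) ^ (1 + 1/m) := by rw [add_comm, Real.rpow_add_one hX.ne']
    _ = _ := by
      rw [Real.mul_rpow hc.hC.le (Real.rpow_nonneg hg.le _), ← Real.rpow_mul hg.le]
      congr 2; ring

lemma BB_cont (hm0 : 0 < m) (hN : 2 ≤ N) (hc : Core N m a T C v)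
    (hK : IntegrableOn (fun r => gg N r ^ ((1+1/m)/2) * wt N r) (Ioi 0)) :
    Continuous (Function.uncurry (BB N m v)) := by
  unfold BB Function.uncurry
  refine continuous_of_dominated (bound := fun r => C ^ (1+1/m) * (gg N r ^ ((1+1/m)/2) * wt N r)) ?_ ?_ (hK.const_mul _) ?_
  · intro p
    refine Continuous.aestronglyMeasurable ?_
    exact ((hc.cont.comp (f := fun r => (r, p.1)) (by fun_prop)).mul ((wcont hm0 hc.cont).comp (f := fun r => (r, p.2)) (by fun_prop))).mul (wt_cont N)
  · intro p
    filter_upwards [self_mem_ae_restrict measurableSet_Ioi] with r hr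
    have hw := wt_pos (N := N) hr
    rw [Real.norm_of_nonneg (mul_nonneg (mul_nonneg (hc.nn _ _) (Real.rpow_nonneg (hc.nn _ _) _)) hw.le), ← mul_assoc]
    exact mul_le_mul_of_nonneg_right (v_bd hm0 hN hc hr _ _) hw.le
  · refine Eventually.of_forall (fun r => ?_)
    exact ((hc.cont.comp (f := fun p : ℝ × ℝ => (r, p.1)) (by fun_prop)).mul ((wcont hm0 hc.cont).comp (f := fun p : ℝ × ℝ => (r, p.2)) (by fun_prop))).mul continuous_const

lemma BB_int (hm0 : 0 < m) (hN : 2 ≤ N) (hc : Core N m a T C v)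
    (hK : IntegrableOn (fun r => gg N r ^ ((1+1/m)/2) * wt N r) (Ioi 0)) (s t : ℝ) :
    IntegrableOn (fun r => v r s * v r t ^ m * wt N r) (Ioi 0) := by
  refine Integrable.mono' (hK.const_mul (C ^ (1+1/m))) ?_ ?_
  · refine Continuous.aestronglyMeasurable ?_
    exact ((hc.cont.comp (f := fun r => (r, s)) (by fun_prop)).mul ((wcont hm0 hc.cont).comp (f := fun r => (r, t)) (by fun_prop))).mul (wt_cont N)
  · filter_upwards [self_mem_ae_restrict measurableSet_Ioi] with r hr
    have hw := wt_pos (N := N) hr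
    rw [Real.norm_of_nonneg (mul_nonneg (mul_nonneg (hc.nn _ _) (Real.rpow_nonneg (hc.nn _ _) _)) hw.le), ← mul_assoc]
    exact mul_le_mul_of_nonneg_right (v_bd hm0 hN hc hr _ _) hw.le

lemma BB_pos (hm0 : 0 < m) (hN : 2 ≤ N) (hc : Core N m a T C v)
    (hK : IntegrableOn (fun r => gg N r ^ ((1+1/m)/2) * wt N r) (Ioi 0)) {s t : ℝ} (hs : s ∈ Ico a T) (ht : t ∈ Ico a T) :
    0 < BB N m v s t := by
  have hp : ∀ r ∈ Ioi (0:ℝ), 0 < v r s * v r t ^ m * wt N r := fun r hr =>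
    mul_pos (mul_pos (hc.pos r s hs) (Real.rpow_pos_of_pos (hc.pos r t ht) _)) (wt_pos hr)
  unfold BB
  rw [setIntegral_pos_iff_support_of_nonneg_ae _ (BB_int hm0 hN hc hK s t)]
  · have : Function.support (fun r => v r s * v r t ^ m * wt N r) ∩ Ioi 0 = Ioi 0 :=
      inter_eq_right.2 (fun r hr => (hp r hr).ne')
    rw [this]; simp
  · filter_upwards [self_mem_ae_restrict measurableSet_Ioi] with r hr
    exact (hp r hr).le

lemma BB_nn (hc : Core N m a T C v) (s t : ℝ) : 0 ≤ BB N m v s t :=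
  setIntegral_nonneg measurableSet_Ioi (fun r hr => mul_nonneg (mul_nonneg (hc.nn _ _) (Real.rpow_nonneg (hc.nn _ _) _)) (wt_pos hr).le)

lemma AA_eq_BB (hm0 : 0 < m) (hN : 2 ≤ N) (hc : Core N m a T C v)
    (hK : IntegrableOn (fun r => gg N r ^ ((1+1/m)/2) * wt N r) (Ioi 0)) (s : ℝ) {t : ℝ} (ht : t ≤ T) :
    IntegrableOn (fun r => v r s * UU m T v r t * wt N r) (Ioi 0) ∧
    AA N m T v s t = ∫ τ in t..T, BB N m v s τ := by
  have hpi : Integrable (Function.uncurry (fun (r τ : ℝ) => v r s * v r τ ^ m * wt N r))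
      ((volume.restrict (Ioi 0)).prod (volume.restrict (Ioc t T))) := by
    have hdom : Integrable (fun p : ℝ × ℝ => C ^ (1+1/m) * (gg N p.1 ^ ((1+1/m)/2) * wt N p.1))
      ((volume.restrict (Ioi 0)).prod (volume.restrict (Ioc t T))) :=
      (hK.const_mul (C ^ (1+1/m))).comp_fst _
    refine Integrable.mono' hdom ?_ ?_
    · refine Continuous.aestronglyMeasurable ?_
      exact ((hc.cont.comp (f := fun p : ℝ × ℝ => (p.1, s)) (by fun_prop)).mul (wcont hm0 hc.cont)).mul ((wt_cont N).comp continuous_fst)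
    · have : ∀ᵐ p : ℝ × ℝ ∂((volume.restrict (Ioi (0:ℝ))).prod (volume.restrict (Ioc t T))), p.1 ∈ Ioi (0:ℝ) :=
        Measure.quasiMeasurePreserving_fst.ae (self_mem_ae_restrict measurableSet_Ioi)
      filter_upwards [this] with p hr
      have hw := wt_pos (N := N) hr
      simp only [Function.uncurry]
      rw [Real.norm_of_nonneg (mul_nonneg (mul_nonneg (hc.nn _ _) (Real.rpow_nonneg (hc.nn _ _) _)) hw.le), ← mul_assoc]
      exact mul_le_mul_of_nonneg_right (v_bd hm0 hN hc hr _ _) hw.le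
  have e : ∀ r, v r s * UU m T v r t * wt N r = ∫ τ in Ioc t T, v r s * v r τ ^ m * wt N r := by
    intro r
    unfold UU
    rw [intervalIntegral.integral_of_le ht, integral_mul_const, integral_const_mul]
  constructor
  · have := hpi.integral_prod_left
    refine this.congr (Eventually.of_forall fun r => ?_)
    exact (e r).symm
  · unfold AA BB
    rw [intervalIntegral.integral_of_le ht, ← integral_integral_swap hpi]
    refine integral_congr_ae (Eventually.of_forall fun r => e r)

lemma AA_eq_mm (hm0 : 0 < m) (hN : 2 ≤ N) (hc : Core N m a T C v)
    (hK : IntegrableOn (fun r => gg N r ^ ((1+1/m)/2) * wt N r) (Ioi 0)) (s : ℝ) {t : ℝ} (ht : t ∈ Icc a T) :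
    IntegrableOn (fun ρ => (wt N ρ)⁻¹ * mm N v ρ s * mm N v ρ t) (Ioi 0) ∧
    AA N m T v s t = ∫ ρ in Ioi (0:ℝ), (wt N ρ)⁻¹ * mm N v ρ s * mm N v ρ t := by
  obtain ⟨hA, -⟩ := AA_eq_BB hm0 hN hc hK s ht.2
  set F : ℝ → ℝ → ℝ := fun r ρ => (Ioi r).indicator (fun ρ => v r s * wt N r * ((wt N ρ)⁻¹ * mm N v ρ t)) ρ with hF
  have cv : Continuous (fun r => v r s) := hc.cont.comp (f := fun r => (r, s)) (by fun_prop)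
  have cmm : ∀ t, Continuous (fun ρ => mm N v ρ t) := fun t => (mm_cont hc.cont).comp (f := fun ρ => (ρ, t)) (by fun_prop)
  have eI : ∀ r > 0, ∫ ρ in Ioi (0:ℝ), F r ρ = v r s * UU m T v r t * wt N r := by
    intro r hr
    simp only [hF]
    rw [integral_indicator measurableSet_Ioi, Measure.restrict_restrict measurableSet_Ioi,
      inter_eq_left.2 (Ioi_subset_Ioi hr.le), integral_const_mul, ← (hc.rep r hr t ht).2]
    unfold UU; ring
  have Fnn : ∀ r > 0, ∀ ρ > 0, 0 ≤ F r ρ := by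
    intro r hr ρ hρ
    simp only [hF]
    refine indicator_nonneg (fun ρ hρ => ?_) ρ
    have hρ' : 0 < ρ := hr.trans hρ
    exact mul_nonneg (mul_nonneg (hc.nn _ _) (wt_pos hr).le) (mul_nonneg (inv_nonneg.2 (wt_pos hρ').le) (mm_nn hc hρ'.le t))
  have mF : Measurable (Function.uncurry F) := by
    have : Function.uncurry F = indicator {p : ℝ × ℝ | p.1 < p.2} (fun p => v p.1 s * wt N p.1 * ((wt N p.2)⁻¹ * mm N v p.2 t)) := by
      ext p
      simp only [hF, Function.uncurry, indicator, mem_Ioi, mem_setOf_eq]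
    rw [this]
    refine Measurable.indicator ?_ (measurableSet_lt measurable_fst measurable_snd)
    exact ((cv.measurable.comp measurable_fst).mul ((wt_cont N).measurable.comp measurable_fst)).mul
      (((wt_cont N).measurable.comp measurable_snd).inv.mul ((cmm t).measurable.comp measurable_snd))
  have hpi : Integrable (Function.uncurry F) ((volume.restrict (Ioi 0)).prod (volume.restrict (Ioi 0))) := by
    rw [integrable_prod_iff mF.aestronglyMeasurable]
    constructor
    · filter_upwards [self_mem_ae_restrict measurableSet_Ioi] with r hr
      simp only [Function.uncurry, hF]
      rw [integrable_indicator_iff measurableSet_Ioi, IntegrableOn, Measure.restrict_restrict measurableSet_Ioi,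
        inter_eq_left.2 (Ioi_subset_Ioi (le_of_lt hr))]
      exact (hc.rep r hr t ht).1.const_mul _
    · refine hA.congr ?_
      filter_upwards [self_mem_ae_restrict measurableSet_Ioi] with r hr
      rw [← eI r hr]
      refine setIntegral_congr_fun measurableSet_Ioi (fun ρ hρ => ?_)
      exact (Real.norm_of_nonneg (Fnn r hr ρ hρ)).symm
  have eJ : ∀ ρ > 0, ∫ r in Ioi (0:ℝ), F r ρ = (wt N ρ)⁻¹ * mm N v ρ s * mm N v ρ t := by
    intro ρ hρ
    have : ∀ r, F r ρ = (Iio ρ).indicator (fun r => ((wt N ρ)⁻¹ * mm N v ρ t) * (wt N r * v r s)) r := by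
      intro r
      simp only [hF, indicator, mem_Ioi, mem_Iio]
      split_ifs
      · ring
      · rfl
    simp_rw [this]
    rw [integral_indicator measurableSet_Iio, Measure.restrict_restrict measurableSet_Iio, integral_const_mul,
      Iio_inter_Ioi, ← integral_Ioc_eq_integral_Ioo, ← intervalIntegral.integral_of_le hρ.le]
    unfold mm; ring
  constructor
  · refine hpi.integral_prod_right.congr ?_
    filter_upwards [self_mem_ae_restrict measurableSet_Ioi] with ρ hρ
    exact eJ ρ hρ
  · unfold AA
    rw [← setIntegral_congr_fun measurableSet_Ioi (fun ρ hρ => eJ ρ hρ), ← integral_integral_swap hpi]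
    exact setIntegral_congr_fun measurableSet_Ioi (fun r hr => (eI r hr).symm)

lemma AA_symm (hm0 : 0 < m) (hN : 2 ≤ N) (hc : Core N m a T C v)
    (hK : IntegrableOn (fun r => gg N r ^ ((1+1/m)/2) * wt N r) (Ioi 0)) {s t : ℝ} (hs : s ∈ Icc a T) (ht : t ∈ Icc a T) :
    AA N m T v s t = AA N m T v t s := by
  rw [(AA_eq_mm hm0 hN hc hK s ht).2, (AA_eq_mm hm0 hN hc hK t hs).2]
  congr 1; ext ρ; ring

lemma AA_cs (hm0 : 0 < m) (hN : 2 ≤ N) (hc : Core N m a T C v)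
    (hK : IntegrableOn (fun r => gg N r ^ ((1+1/m)/2) * wt N r) (Ioi 0)) {s t : ℝ} (hs : s ∈ Icc a T) (ht : t ∈ Icc a T) :
    AA N m T v s t ^ 2 ≤ AA N m T v s s * AA N m T v t t := by
  rw [(AA_eq_mm hm0 hN hc hK s ht).2]
  obtain ⟨is, es⟩ := AA_eq_mm hm0 hN hc hK s hs
  obtain ⟨it, et⟩ := AA_eq_mm hm0 hN hc hK t ht
  rw [es, et]
  have cmm : ∀ t, Continuous (fun ρ => mm N v ρ t) := fun t => (mm_cont hc.cont).comp (f := fun ρ => (ρ, t)) (by fun_prop)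
  have e2 : ∀ x y, EqOn (fun ρ => (Real.sqrt (wt N ρ)⁻¹ * mm N v ρ x) * (Real.sqrt (wt N ρ)⁻¹ * mm N v ρ y))
      (fun ρ => (wt N ρ)⁻¹ * mm N v ρ x * mm N v ρ y) (Ioi 0) := by
    intro x y ρ hρ
    have := Real.mul_self_sqrt (inv_nonneg.2 (wt_pos (N := N) hρ).le)
    simp only
    linear_combination mm N v ρ x * mm N v ρ y * this
  have e3 : ∀ x, EqOn (fun ρ => (Real.sqrt (wt N ρ)⁻¹ * mm N v ρ x)^2)
      (fun ρ => (wt N ρ)⁻¹ * mm N v ρ x * mm N v ρ x) (Ioi 0) := by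
    intro x ρ hρ
    have := e2 x x hρ
    simp only at this ⊢
    rw [← this]; ring
  have ms : ∀ x, AEStronglyMeasurable (fun ρ => Real.sqrt (wt N ρ)⁻¹ * mm N v ρ x) (volume.restrict (Ioi 0)) := fun x =>
    (((wt_cont N).measurable.inv.sqrt).mul (cmm x).measurable).aestronglyMeasurable
  have := (cs_lemma (ms s) (ms t) ((integrableOn_congr_fun (e3 s) measurableSet_Ioi).2 is)
    ((integrableOn_congr_fun (e3 t) measurableSet_Ioi).2 it)).2
  rwa [setIntegral_congr_fun measurableSet_Ioi (e2 s t), setIntegral_congr_fun measurableSet_Ioi (e3 s),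
    setIntegral_congr_fun measurableSet_Ioi (e3 t)] at this

lemma UU_E (hm0 : 0 < m) (hN : 2 ≤ N) (hc : Core N m a T C v)
    (hK : IntegrableOn (fun r => gg N r ^ ((1+1/m)/2) * wt N r) (Ioi 0)) {r t : ℝ} (ht : t ∈ Icc a T) (hr : 0 < r) :
    UU m T v r t ^ 2 ≤ gg N r * AA N m T v t t := by
  obtain ⟨it, et⟩ := AA_eq_mm hm0 hN hc hK t ht
  have cmm : Continuous (fun ρ => mm N v ρ t) := (mm_cont hc.cont).comp (f := fun ρ => (ρ, t)) (by fun_prop)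
  have e : EqOn (fun ρ => ((wt N ρ)⁻¹ * mm N v ρ t)^2 * wt N ρ) (fun ρ => (wt N ρ)⁻¹ * mm N v ρ t * mm N v ρ t) (Ioi 0) := by
    intro ρ hρ
    have := (wt_pos (N := N) hρ).ne'
    simp only
    field_simp
  have hi : IntegrableOn (fun ρ => ((wt N ρ)⁻¹ * mm N v ρ t)^2 * wt N ρ) (Ioi 0) :=
    (integrableOn_congr_fun e measurableSet_Ioi).2 it
  have h := (wcs hN hr (f := fun ρ => (wt N ρ)⁻¹ * mm N v ρ t)
    (((wt_cont N).measurable.inv.mul cmm.measurable).aestronglyMeasurable) (hi.mono_set (Ioi_subset_Ioi hr.le))).2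
  rw [← (hc.rep r hr t ht).2] at h
  refine h.trans ?_
  refine mul_le_mul_of_nonneg_left ?_ (gg_pos hN hr).le
  rw [et, ← setIntegral_congr_fun measurableSet_Ioi e]
  refine setIntegral_mono_set hi ?_ (Ioi_subset_Ioi hr.le).eventuallyLE
  filter_upwards [self_mem_ae_restrict measurableSet_Ioi] with ρ hρ
  exact mul_nonneg (sq_nonneg _) (wt_pos hρ).le

end


lemma young_pt {m x y : ℝ} (hm0 : 0 < m) (hx : 0 ≤ x) (hy : 0 ≤ y) :
    (m+1) * (x * y^m) ≤ x * x^m + m * (y * y^m) := by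
  have h := Real.geom_mean_le_arith_mean2_weighted (show 0 ≤ 1/(m+1) by positivity) (show 0 ≤ m/(m+1) by positivity)
    (Real.rpow_nonneg hx (m+1)) (Real.rpow_nonneg hy (m+1)) (by field_simp; ring)
  rw [← Real.rpow_mul hx, ← Real.rpow_mul hy, mul_one_div_cancel (by positivity), Real.rpow_one,
    mul_div_cancel₀ _ (by positivity), Real.rpow_add_one' hx (by positivity), Real.rpow_add_one' hy (by positivity)] at h
  calc _ ≤ (m+1) * (1/(m+1) * (x^m*x) + m/(m+1)*(y^m*y)) := by gcongr
    _ = _ := by field_simp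

section
variable {N : ℕ} {m a T C : ℝ} {v : ℝ → ℝ → ℝ}

lemma BB_young (hm0 : 0 < m) (hN : 2 ≤ N) (hc : Core N m a T C v)
    (hK : IntegrableOn (fun r => gg N r ^ ((1+1/m)/2) * wt N r) (Ioi 0)) (s t : ℝ) :
    (m+1) * BB N m v s t ≤ BB N m v s s + m * BB N m v t t := by
  unfold BB
  have i := BB_int hm0 hN hc hK
  rw [← integral_const_mul, ← integral_const_mul, ← integral_add (i s s) ((i t t).const_mul m)]
  refine setIntegral_mono_on ((i s t).const_mul _) ((i s s).add ((i t t).const_mul m)) measurableSet_Ioi (fun r hr => ?_)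
  have := mul_le_mul_of_nonneg_right (young_pt hm0 (hc.nn r s) (hc.nn r t)) (wt_pos (N := N) hr).le
  linarith

lemma AA_pos (hm0 : 0 < m) (hN : 2 ≤ N) (hc : Core N m a T C v)
    (hK : IntegrableOn (fun r => gg N r ^ ((1+1/m)/2) * wt N r) (Ioi 0)) {t : ℝ} (ht : t ∈ Ico a T) :
    0 < AA N m T v t t := by
  rw [(AA_eq_BB hm0 hN hc hK t ht.2.le).2]
  refine intervalIntegral.intervalIntegral_pos_of_pos_on ?_ (fun τ hτ => BB_pos hm0 hN hc hK ht ⟨ht.1.trans hτ.1.le, hτ.2⟩) ht.2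
  exact ((BB_cont hm0 hN hc hK).comp (f := fun τ => (t, τ)) (by fun_prop)).intervalIntegrable _ _

lemma BB_lower (hm0 : 0 < m) (hN : 2 ≤ N) (hc : Core N m a T C v)
    (hK : IntegrableOn (fun r => gg N r ^ ((1+1/m)/2) * wt N r) (Ioi 0)) :
    ∃ c > 0, ∀ t ∈ Ico a T, c * AA N m T v t t ^ ((m+1)/2) ≤ BB N m v t t := by
  set K := (∫ r in Ioi (0:ℝ), gg N r ^ ((1+1/m)/2) * wt N r) + 1 with hKd
  have hKpos : 0 < K := by
    have : 0 ≤ ∫ r in Ioi (0:ℝ), gg N r ^ ((1+1/m)/2) * wt N r := setIntegral_nonneg measurableSet_Ioi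
      (fun r hr => mul_nonneg (Real.rpow_nonneg (gg_pos hN hr).le _) (wt_pos hr).le)
    linarith
  refine ⟨K * (K ^ (m+1))⁻¹, by positivity, fun t ht => ?_⟩
  have ht' : t ∈ Icc a T := ⟨ht.1, ht.2.le⟩
  set E := AA N m T v t t with hE
  have hEp : 0 < E := AA_pos hm0 hN hc hK ht
  set q := E ^ ((1:ℝ)/2) with hq
  have hqp : 0 < q := Real.rpow_pos_of_pos hEp _
  have hqq : q * q = E := by rw [hq, ← Real.rpow_add hEp]; norm_num
  have hU : ∀ r > 0, UU m T v r t ≤ q * gg N r ^ ((1:ℝ)/2) := by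
    intro r hr
    have h := UU_E hm0 hN hc hK ht' hr
    have hg := gg_pos hN hr
    refine abs_le_of_sq_le_sq' ?_ (by positivity) |>.2
    rw [mul_pow, ← Real.sqrt_eq_rpow, Real.sq_sqrt hg.le, pow_two q, hqq]; linarith
  have hl : 0 < K / q := by positivity
  have hpt : ∀ r ∈ Ioi (0:ℝ), (m+1) * (K / q) / q * (v r t * UU m T v r t * wt N r) ≤
      (K/q)^(m+1) * (v r t * v r t ^ m * wt N r) + m * (gg N r ^ ((1+1/m)/2) * wt N r) := by
    intro r hr
    have hg := gg_pos hN hr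
    have hw := wt_pos (N := N) hr
    have h1 := young_pt hm0 (mul_nonneg hl.le (hc.nn r t)) (Real.rpow_nonneg hg.le (1/(2*m)))
    have e1 : (gg N r ^ (1/(2*m)))^m = gg N r ^ ((1:ℝ)/2) := by
      rw [← Real.rpow_mul hg.le]; congr 1; field_simp
    have e2 : gg N r ^ (1/(2*m)) * gg N r ^ ((1:ℝ)/2) = gg N r ^ ((1+1/m)/2) := by
      rw [← Real.rpow_add hg]; congr 1; field_simp; ring
    rw [e1, e2, Real.mul_rpow hl.le (hc.nn r t)] at h1
    have e3 : (K/q)^(m+1) = (K/q)^m * (K/q) := Real.rpow_add_one hl.ne' m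
    have h2 : (m+1) * (K / q) / q * (v r t * UU m T v r t) ≤ (m+1) * ((K/q) * v r t * gg N r ^ ((1:ℝ)/2)) := by
      have := hU r hr
      have hv := hc.nn r t
      calc _ ≤ (m+1) * (K / q) / q * (v r t * (q * gg N r ^ ((1:ℝ)/2))) := by gcongr
        _ = _ := by field_simp
    have h3 := mul_le_mul_of_nonneg_right (h2.trans h1) hw.le
    rw [e3]
    linarith
  have iA := (AA_eq_BB hm0 hN hc hK t ht.2.le).1
  have iB := BB_int hm0 hN hc hK t t
  have hint := setIntegral_mono_on (iA.const_mul ((m+1) * (K / q) / q)) ((iB.const_mul ((K/q)^(m+1))).add (hK.const_mul m)) measurableSet_Ioi hpt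
  have e0 := integral_add (iB.const_mul ((K/q)^(m+1))) (hK.const_mul m)
  simp only [Pi.add_apply] at hint
  rw [e0, integral_const_mul, integral_const_mul, integral_const_mul] at hint
  have hint' : (m+1) * (K/q)/q * E ≤ (K/q)^(m+1) * BB N m v t t + m * (K - 1) := by
    have : (∫ r in Ioi (0:ℝ), gg N r ^ ((1+1/m)/2) * wt N r) = K - 1 := by rw [hKd]; ring
    rw [this] at hint
    exact hint
  have e4 : (m+1) * (K/q)/q * E = (m+1) * K := by rw [← hqq]; field_simp
  have h5 : K ≤ (K/q)^(m+1) * BB N m v t t := by nlinarith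
  have e6 : E ^ ((m+1)/2) = q ^ (m+1) := by rw [hq, ← Real.rpow_mul hEp.le]; congr 1; ring
  rw [e6]
  rw [Real.div_rpow hKpos.le hqp.le] at h5
  have k1 : 0 < K^(m+1) := by positivity
  have k2 : 0 < q^(m+1) := by positivity
  calc K * (K^(m+1))⁻¹ * q^(m+1) ≤ (K^(m+1) / q^(m+1) * BB N m v t t) * (K^(m+1))⁻¹ * q^(m+1) := by gcongr
    _ = BB N m v t t := by field_simp
end


lemma taylor_pow {m η : ℝ} (hη : 0 < η) :
    ∀ᶠ x in 𝓝 (0:ℝ), 1 - (1-m)*x - ((1-m)*(m/2) + η)*x^2 ≤ (1-x)^(1-m) := by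
  set f : ℝ → ℝ := fun x => (1-x)^(1-m) + (1-m)*x + ((1-m)*(m/2) + η)*x^2 with hf
  have hd : ∀ x < 1, HasDerivAt f (-1 * (1-m) * (1-x)^(1-m-1) + (1-m) * 1 + ((1-m)*(m/2) + η)*(2*x)) x := by
    intro x hx
    have h1 : HasDerivAt (fun x : ℝ => 1 - x) (-1) x := by simpa using (hasDerivAt_id x).const_sub 1
    have h2 := h1.rpow_const (p := 1-m) (Or.inl (by linarith))
    have h3 := (hasDerivAt_id x).const_mul (1-m)
    have h4 := (hasDerivAt_pow 2 x).const_mul ((1-m)*(m/2)+η)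
    refine ((h2.add h3).add h4).congr_deriv ?_
    simp
  have e1 : deriv f =ᶠ[𝓝 0] fun x => -1 * (1-m) * (1-x)^(1-m-1) + (1-m) * 1 + ((1-m)*(m/2) + η)*(2*x) := by
    filter_upwards [Iio_mem_nhds (zero_lt_one' ℝ)] with x hx
    exact (hd x hx).deriv
  have e2 : HasDerivAt (fun x : ℝ => -1 * (1-m) * (1-x)^(1-m-1) + (1-m) * 1 + ((1-m)*(m/2) + η)*(2*x)) (2*η) 0 := by
    have h1 : HasDerivAt (fun x : ℝ => 1 - x) (-1) 0 := by simpa using (hasDerivAt_id (0:ℝ)).const_sub 1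
    have h2 := (h1.rpow_const (p := 1-m-1) (Or.inl (by norm_num))).const_mul (-1*(1-m))
    have h4 := ((hasDerivAt_id (0:ℝ)).const_mul 2).const_mul ((1-m)*(m/2)+η)
    have h5 := (h2.add_const ((1-m)*1)).add h4
    refine h5.congr_deriv ?_
    simp; ring
  have hmin : IsLocalMin f 0 := by
    refine isLocalMin_of_deriv_deriv_pos ?_ ?_ (hd 0 one_pos).continuousAt
    · rw [e1.deriv_eq, e2.deriv]; linarith
    · rw [(hd 0 one_pos).deriv]; simp
  have h0 : f 0 = 1 := by simp [hf]
  filter_upwards [hmin] with x hx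
  rw [h0] at hx
  simp only [hf] at hx
  linarith

lemma hasDeriv_of_factor {f g : ℝ → ℝ} {t : ℝ} (h : ∀ᶠ s in 𝓝 t, f s = f t + (s - t) * g s) (hg : ContinuousAt g t) :
    HasDerivAt f (g t) t := by
  rw [hasDerivAt_iff_tendsto_slope]
  refine (hg.tendsto.mono_left nhdsWithin_le_nhds).congr' ?_
  filter_upwards [h.filter_mono nhdsWithin_le_nhds, self_mem_nhdsWithin] with s hs hne
  have : s - t ≠ 0 := sub_ne_zero.2 hne
  rw [slope_def_field, hs]; field_simp; ring

set_option maxHeartbeats 1000000 in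
lemma ext_rate {m a T c : ℝ} (hm0 : 0 < m) (hm1 : m < 1) (haT : a < T) {B A : ℝ → ℝ → ℝ}
    (cB : Continuous (Function.uncurry B)) (hB0 : ∀ s t, 0 ≤ B s t)
    (hA : ∀ s, ∀ t ≤ T, A s t = ∫ τ in t..T, B s τ)
    (sym : ∀ s ∈ Icc a T, ∀ t ∈ Icc a T, A s t = A t s)
    (cs : ∀ s ∈ Icc a T, ∀ t ∈ Icc a T, A s t ^ 2 ≤ A s s * A t t)
    (pos : ∀ t ∈ Ico a T, 0 < A t t)
    (young : ∀ s t, (m+1) * B s t ≤ B s s + m * B t t)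
    (hc : 0 < c) (low : ∀ t ∈ Ico a T, c * A t t ^ ((m+1)/2) ≤ B t t) :
    (∃ c1 > 0, ∀ t ∈ Ico a T, c1 * (T-t)^(2/(1-m)) ≤ A t t) ∧
    (∃ C1 > 0, ∀ t ∈ Ico a T, A t t ≤ C1 * (T-t)^(2/(1-m))) := by
  have hϑ : 0 < 1 - m := by linarith
  have cBs : ∀ s, Continuous (fun τ => B s τ) := fun s => cB.comp (f := fun τ => (s, τ)) (by fun_prop)
  have cy : Continuous (fun τ => B τ τ) := cB.comp (f := fun τ => (τ, τ)) (by fun_prop)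
  have iB : ∀ s x y, IntervalIntegrable (fun τ => B s τ) volume x y := fun s x y => (cBs s).intervalIntegrable x y
  set E : ℝ → ℝ := fun t => A t t with hE
  have posE : ∀ t ∈ Ico a T, 0 < E t := pos
  have lowE : ∀ t ∈ Ico a T, c * E t ^ ((m+1)/2) ≤ B t t := low
  have cE : ContinuousOn E (Icc a T) := by
    have : Continuous (fun t => - ∫ τ in T..t, B t τ) :=
      (intervalIntegral.continuous_parametric_intervalIntegral_of_continuous cB continuous_id).neg
    refine this.continuousOn.congr (fun t ht => ?_)
    simp only [hE]
    rw [hA t t ht.2, intervalIntegral.integral_symm]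
  have hdiff : ∀ s, ∀ t ≤ T, ∀ t' ≤ T, A s t - A s t' = ∫ τ in t..t', B s τ := by
    intro s t ht t' ht'
    rw [hA s t ht, hA s t' ht', ← intervalIntegral.integral_add_adjacent_intervals (iB s t t') (iB s t' T)]; ring
  have ET : E T = 0 := by simp only [hE]; rw [hA T T le_rfl]; simp
  have dE : ∀ t ∈ Ioo a T, HasDerivAt E (-(2 * B t t)) t := by
    intro t ht
    set g : ℝ → ℝ := fun s => -((∫ θ in (0:ℝ)..1, B s (t + (s-t)*θ)) + ∫ θ in (0:ℝ)..1, B t (t + (s-t)*θ)) with hg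
    have cg : Continuous g := by
      refine (Continuous.add ?_ ?_).neg
      · exact intervalIntegral.continuous_parametric_intervalIntegral_of_continuous' (f := fun s θ => B s (t+(s-t)*θ))
          (cB.comp (f := fun p : ℝ × ℝ => (p.1, t + (p.1-t)*p.2)) (by fun_prop)) 0 1
      · exact intervalIntegral.continuous_parametric_intervalIntegral_of_continuous' (f := fun s θ => B t (t+(s-t)*θ))
          (cB.comp (f := fun p : ℝ × ℝ => (t, t + (p.1-t)*p.2)) (by fun_prop)) 0 1
    have hgt : g t = -(2 * B t t) := by simp [hg]; ring
    rw [← hgt]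
    refine hasDeriv_of_factor ?_ cg.continuousAt
    filter_upwards [Ioo_mem_nhds ht.1 ht.2] with s hs
    have hs' : s ∈ Icc a T := ⟨hs.1.le, hs.2.le⟩
    have ht' : t ∈ Icc a T := ⟨ht.1.le, ht.2.le⟩
    have k : ∀ x, (s-t) * ∫ θ in (0:ℝ)..1, B x (t+(s-t)*θ) = ∫ τ in t..s, B x τ := by
      intro x
      have := intervalIntegral.smul_integral_comp_add_mul (a := 0) (b := 1) (fun τ => B x τ) (s-t) t
      rw [smul_eq_mul] at this
      rw [this]; congr 1 <;> ring
    have h1 := hdiff s t ht.2.le s hs.2.le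
    have h2 := hdiff t t ht.2.le s hs.2.le
    have h3 := sym s hs' t ht'
    simp only [hE, hg]
    rw [mul_neg, mul_add, k s, k t]
    linarith
  set φ : ℝ → ℝ := fun t => E t ^ ((1-m)/2) with hφ
  have cφ : ContinuousOn φ (Icc a T) := cE.rpow_const (fun _ _ => Or.inr (by positivity))
  have φT : φ T = 0 := by simp only [hφ]; rw [ET, Real.zero_rpow (by positivity)]
  have φpos : ∀ t ∈ Ico a T, 0 < φ t := fun t ht => Real.rpow_pos_of_pos (posE t ht) _
  have Eφ : ∀ t ∈ Ico a T, E t = φ t ^ (2/(1-m)) := by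
    intro t ht
    simp only [hφ]
    rw [← Real.rpow_mul (posE t ht).le, show (1-m)/2 * (2/(1-m)) = 1 by field_simp, Real.rpow_one]
  have dφ : ∀ t ∈ Ioo a T, HasDerivAt φ (-(1-m) * (B t t / E t) * φ t) t := by
    intro t ht
    have hp := posE t ⟨ht.1.le, ht.2⟩
    have := (dE t ht).rpow_const (p := (1-m)/2) (Or.inl hp.ne')
    refine this.congr_deriv ?_
    simp only [hφ]
    rw [Real.rpow_sub_one hp.ne']
    ring
  have hexp : ∀ q : ℝ, 0 < q → ∀ t ∈ Ico a T, (q * (T-t))^(2/(1-m)) = q^(2/(1-m)) * (T-t)^(2/(1-m)) := fun q hq t ht =>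
    Real.mul_rpow hq.le (by linarith [ht.2])
  constructor
  · refine ⟨((1-m)*c)^(2/(1-m)), by positivity, fun t ht => ?_⟩
    have hanti : AntitoneOn (fun t => φ t + (1-m)*c*t) (Icc a T) := by
      refine antitoneOn_of_deriv_nonpos (convex_Icc a T) (cφ.add (by fun_prop)) ?_ ?_
      · rw [interior_Icc]
        intro t ht
        exact ((dφ t ht).add ((hasDerivAt_id t).const_mul ((1-m)*c))).differentiableAt.differentiableWithinAt
      · rw [interior_Icc]
        intro t ht
        have hp := posE t ⟨ht.1.le, ht.2⟩
        have hd := ((dφ t ht).add ((hasDerivAt_id t).const_mul ((1-m)*c))).deriv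
        have hd' : deriv (fun t => φ t + (1-m)*c*t) t = -(1-m) * (B t t / E t) * φ t + (1-m)*c*1 := hd
        rw [hd']
        have hl := lowE t ⟨ht.1.le, ht.2⟩
        have e : c = (c * E t ^ ((m+1)/2)) / E t * φ t := by
          simp only [hφ]
          rw [div_mul_eq_mul_div, mul_assoc, ← Real.rpow_add hp, show (m+1)/2 + (1-m)/2 = 1 by ring, Real.rpow_one]
          field_simp
        have h2 : c ≤ B t t / E t * φ t := by
          rw [e]
          have := (φpos t ⟨ht.1.le, ht.2⟩).le
          gcongr
        nlinarith
    have h := hanti ⟨ht.1, ht.2.le⟩ ⟨haT.le, le_rfl⟩ ht.2.le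
    simp only [φT] at h
    have h2 : (1-m)*c*(T-t) ≤ φ t := by linarith
    change _ ≤ E t
    rw [Eφ t ht, ← hexp _ (by positivity) t ht]
    exact Real.rpow_le_rpow (mul_nonneg (by positivity) (by linarith [ht.2])) h2 (by positivity)
  · have ha : a ∈ Ico a T := ⟨le_rfl, haT⟩
    have hTa : 0 < T - a := by linarith
    have φa := φpos a ha
    have key : ∀ δ > 0, ∀ t ∈ Icc a T, φ t - φ a / (T-a) * (T-t) + δ * ((t-a)*(t-T)) ≤ 0 := by
      intro δ hδ
      by_contra! hcon
      obtain ⟨t0, ht0, hpos⟩ := hcon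
      set ψ : ℝ → ℝ := fun t => φ t - φ a / (T-a) * (T-t) + δ * ((t-a)*(t-T)) with hψ
      have cψ : ContinuousOn ψ (Icc a T) := (cφ.sub (by fun_prop)).add (by fun_prop)
      obtain ⟨t, ht, hmax⟩ := isCompact_Icc.exists_isMaxOn ⟨t0, ht0⟩ cψ
      have hψt : 0 < ψ t := hpos.trans_le (hmax ht0)
      have hta : t ≠ a := by
        rintro rfl
        simp only [hψ] at hψt
        rw [div_mul_cancel₀ _ hTa.ne'] at hψt
        simp at hψt
      have htT : t ≠ T := by
        rintro rfl
        simp only [hψ, φT] at hψt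
        simp at hψt
      have htI : t ∈ Ioo a T := ⟨lt_of_le_of_ne ht.1 hta.symm, lt_of_le_of_ne ht.2 htT⟩
      have htO : t ∈ Ico a T := ⟨ht.1, htI.2⟩
      have hEt := posE t htO
      have hφt := φpos t htO
      set k := B t t / E t with hk
      set α := - (φ a/(T-a)) - δ * (2*t - a - T) with hα
      have hα' : α = -(1-m) * k * φ t := by
        have hd : HasDerivAt ψ (-(1-m) * k * φ t - φ a/(T-a) * (-1) + δ * (1 * (t - T) + (t-a)*1)) t := by
          have h1 : HasDerivAt (fun s : ℝ => T - s) (-1) t := by simpa using (hasDerivAt_id t).const_sub T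
          have h2 := h1.const_mul (φ a/(T-a))
          have h3 := (((hasDerivAt_id t).sub_const a).mul ((hasDerivAt_id t).sub_const T)).const_mul δ
          exact ((dφ t htI).sub h2).add h3
        have := IsLocalMax.hasDerivAt_eq_zero (hmax.isLocalMax (Icc_mem_nhds htI.1 htI.2)) hd
        rw [hα]; linarith
      have hup : ∀ s ∈ Icc a T, φ s ≤ φ t + α * (s-t) - δ * (s-t)^2 := by
        intro s hs
        have h : ψ s ≤ ψ t := hmax hs
        simp only [hψ] at h
        rw [hα]
        linarith
      set η := δ/φ t / (2*(k^2+1)) with hη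
      have hηp : 0 < η := by positivity
      -- x(h)
      set X : ℝ → ℝ := fun s => 1 - Real.sqrt (E s / E t) with hX
      have hXt : X t = 0 := by simp only [hX]; rw [div_self hEt.ne']; simp
      have cX : Tendsto X (𝓝[>] t) (𝓝 0) := by
        have h1 : ContinuousAt E t := (dE t htI).continuousAt
        have h2 : ContinuousAt X t := continuousAt_const.sub (h1.div_const _).sqrt
        have := h2.tendsto
        rw [hXt] at this
        exact this.mono_left nhdsWithin_le_nhds
      have hev := (cX.eventually (taylor_pow (m := m) hηp)).and (Ioo_mem_nhdsGT htI.2)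
      obtain ⟨s, hT, hs⟩ := hev.exists
      have hsI : s ∈ Ico a T := ⟨ht.1.trans hs.1.le, hs.2⟩
      have hsC : s ∈ Icc a T := ⟨hsI.1, hs.2.le⟩
      have hEs := posE s hsI
      have hh : 0 < s - t := by linarith [hs.1]
      set q := Real.sqrt (E s / E t) with hq
      have hq0 : 0 < q := Real.sqrt_pos.2 (div_pos hEs hEt)
      have hqq : q * q = E s / E t := Real.mul_self_sqrt (div_pos hEs hEt).le
      have hXs : X s = 1 - q := rfl
      have dEint : ∫ τ in t..s, -(2 * B τ τ) = E s - E t := by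
        refine intervalIntegral.integral_eq_sub_of_hasDerivAt (fun τ hτ => dE τ ?_) ((continuous_const.mul cy).neg.intervalIntegrable _ _)
        rw [uIcc_of_le hs.1.le] at hτ
        exact ⟨htI.1.trans_le hτ.1, hτ.2.trans_lt hs.2⟩
      have dEint' : ∫ τ in t..s, B τ τ = (E t - E s)/2 := by
        rw [intervalIntegral.integral_neg, intervalIntegral.integral_const_mul] at dEint
        linarith
      have hdec : E s ≤ E t := by
        have : 0 ≤ ∫ τ in t..s, B τ τ := intervalIntegral.integral_nonneg hs.1.le (fun τ _ => hB0 τ τ)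
        linarith
      have hq1 : q ≤ 1 := by
        have : q * q ≤ 1 := by rw [hqq]; exact (div_le_one hEt).2 hdec
        nlinarith
      have hAle : A t s ≤ q * E t := by
        have h := cs t ht s hsC
        refine abs_le_of_sq_le_sq' (h.trans (le_of_eq ?_)) (by positivity) |>.2
        change E t * E s = _
        rw [mul_pow, pow_two q, hqq]; field_simp
      have hstep : (m+1) * (E t - A t s) ≤ (s-t) * B t t + m * ((E t - E s)/2) := by
        have h1 := hdiff t t ht.2 s hs.2.le
        change (m+1) * (A t t - A t s) ≤ _
        rw [h1, ← intervalIntegral.integral_const_mul, ← dEint', ← intervalIntegral.integral_const_mul]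
        have h2 : (s-t) * B t t = ∫ τ in t..s, B t t := by simp
        have ii1 : IntervalIntegrable (fun _ : ℝ => B t t) volume t s := continuous_const.intervalIntegrable _ _
        have ii2 : IntervalIntegrable (fun τ : ℝ => m * B τ τ) volume t s := (continuous_const.mul cy).intervalIntegrable _ _
        rw [h2, ← intervalIntegral.integral_add ii1 ii2]
        exact intervalIntegral.integral_mono_on hs.1.le ((continuous_const.mul (cBs t)).intervalIntegrable _ _)
          ((continuous_const.add (continuous_const.mul cy)).intervalIntegrable _ _) (fun τ _ => young t τ)
      have hBk : B t t = k * E t := by rw [hk]; field_simp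
      have hEsq : E s = q * q * E t := by rw [hqq]; field_simp
      have hk0 : 0 ≤ k := div_nonneg (hB0 t t) hEt.le
      have hx1 : (1-q) + (m/2) * (1-q)^2 ≤ (s-t) * k := by
        rw [hBk, hEsq] at hstep
        have h1 : (m+1) * (1 - q) * E t ≤ ((s-t)*k + m * ((1 - q*q)/2)) * E t := by
          have := mul_le_mul_of_nonneg_left hAle (show 0 ≤ m+1 by linarith)
          linarith
        have h2 := le_of_mul_le_mul_right h1 hEt
        linarith
      have hx2 : 1 - q ≤ (s-t)*k := by
        have : 0 ≤ (m/2)*(1-q)^2 := by positivity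
        linarith
      have hφs : φ s = φ t * q^(1-m) := by
        simp only [hφ]
        rw [hq, Real.sqrt_eq_rpow, ← Real.rpow_mul (div_pos hEs hEt).le, Real.div_rpow hEs.le hEt.le,
          show (1:ℝ)/2 * (1-m) = (1-m)/2 by ring]
        field_simp
      have h6 := hup s hsC
      rw [hXs, show 1 - (1 - q) = q by ring] at hT
      set δ' := δ/φ t with hδ'
      have hδ'p : 0 < δ' := by positivity
      have hδe : δ = δ' * φ t := by rw [hδ']; field_simp
      have h7 : q^(1-m) ≤ 1 - (1-m)*k*(s-t) - δ' * (s-t)^2 := by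
        rw [hφs, hα', hδe] at h6
        have : φ t * q^(1-m) ≤ φ t * (1 - (1-m)*k*(s-t) - δ' * (s-t)^2) := by linarith
        exact le_of_mul_le_mul_left this hφt
      have h8 : δ' * (s-t)^2 ≤ η * (1-q)^2 := by
        have := mul_le_mul_of_nonneg_left hx1 hϑ.le
        linarith
      have h9 : (1-q)^2 ≤ (s-t)^2 * k^2 := by
        rw [← mul_pow]; exact pow_le_pow_left₀ (by linarith) hx2 2
      have h10 : δ' * (s-t)^2 ≤ (η * k^2) * (s-t)^2 := by
        calc _ ≤ _ := h8
          _ ≤ η * ((s-t)^2 * k^2) := by gcongr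
          _ = _ := by ring
      have h11 := le_of_mul_le_mul_right h10 (by positivity)
      have h12 : η * (2*(k^2+1)) = δ' := by rw [hη]; field_simp
      have h13 : 0 ≤ η * k^2 := by positivity
      linarith
    have hfin : ∀ t ∈ Icc a T, φ t ≤ φ a/(T-a) * (T-t) := by
      intro t ht
      refine le_of_forall_pos_le_add (fun e he => ?_)
      have h1 := key (e/((T-a)*(T-a))) (by positivity) t ht
      have h2 : (t-a)*(T-t) ≤ (T-a)*(T-a) := mul_le_mul (by linarith [ht.2]) (by linarith [ht.1]) (by linarith [ht.2]) hTa.le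
      have h3 : e/((T-a)*(T-a)) * ((t-a)*(T-t)) ≤ e/((T-a)*(T-a)) * ((T-a)*(T-a)) := by gcongr
      rw [div_mul_cancel₀ _ (by positivity)] at h3
      nlinarith
    refine ⟨(φ a/(T-a))^(2/(1-m)), by positivity, fun t ht => ?_⟩
    change E t ≤ _
    rw [Eφ t ht, ← hexp _ (by positivity) t ht]
    exact Real.rpow_le_rpow (φpos t ht).le (hfin t ⟨ht.1, ht.2.le⟩) (by positivity)


section
variable {N : ℕ} {m a T C : ℝ} {v : ℝ → ℝ → ℝ}

lemma UU_le_w (hm0 : 0 < m) (hc : Core N m a T C v) {t : ℝ} (ht : t ∈ Ico a T) (r : ℝ) :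
    UU m T v r t ≤ (T - t) * (C * v r t ^ m) := by
  have h := intervalIntegral.integral_mono_on (μ := volume) ht.2.le ((slice_w hm0 hc.cont r).intervalIntegrable _ _)
    (continuous_const (y := C * v r t ^ m) |>.intervalIntegrable _ _) (fun τ hτ => hc.bc r t τ ht.1 hτ.1 hτ.2)
  rwa [intervalIntegral.integral_const, smul_eq_mul] at h

lemma UU_split (hm0 : 0 < m) (hc : Core N m a T C v) (t s r : ℝ) :
    UU m T v r t = (∫ τ in t..s, v r τ ^ m) + UU m T v r s :=
  (intervalIntegral.integral_add_adjacent_intervals ((slice_w hm0 hc.cont r).intervalIntegrable _ _)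
    ((slice_w hm0 hc.cont r).intervalIntegrable _ _)).symm

lemma UU_time (hm0 : 0 < m) (hc : Core N m a T C v) {t s : ℝ} (hts : t ≤ s) (r : ℝ) :
    UU m T v r s ≤ UU m T v r t := by
  rw [UU_split hm0 hc t s r]
  have : 0 ≤ ∫ τ in t..s, v r τ ^ m := intervalIntegral.integral_nonneg hts (fun τ _ => Real.rpow_nonneg (hc.nn r τ) m)
  linarith

lemma w_le_UU (hm0 : 0 < m) (hc : Core N m a T C v) {t s : ℝ} (ht : a ≤ t) (hts : t ≤ s) (hs : s ≤ T) (r : ℝ) :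
    (s - t) * v r s ^ m ≤ C * UU m T v r t := by
  have h := intervalIntegral.integral_mono_on (μ := volume) hts
    (continuous_const (y := v r s ^ m) |>.intervalIntegrable _ _)
    (continuous_const (y := C) |>.mul (slice_w hm0 hc.cont r) |>.intervalIntegrable _ _)
     (fun τ hτ => hc.bc r τ s (ht.trans hτ.1) hτ.2 hs)
  simp only [Pi.mul_apply] at h
  rw [intervalIntegral.integral_const, smul_eq_mul, intervalIntegral.integral_const_mul] at h
  refine h.trans (mul_le_mul_of_nonneg_left ?_ hc.hC.le)
  rw [UU_split hm0 hc t s r]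
  linarith [UU_nn hc hs r]

lemma psi_small (hm0 : 0 < m) (hN : 2 ≤ N)
    (hK : IntegrableOn (fun r => gg N r ^ ((1+1/m)/2) * wt N r) (Ioi 0)) {D e : ℝ} (hD : 0 < D) (he : 0 < e) :
    ∃ x0 > 0, ∀ x, 0 ≤ x → x < x0 →
      (IntegrableOn (fun r => min (D * gg N r ^ ((1:ℝ)/2)) (|x| * max 1 (gg N r / gg N 1)) ^ (1+1/m) * wt N r) (Ioi 0)) ∧
      ∫ r in Ioi (0:ℝ), min (D * gg N r ^ ((1:ℝ)/2)) (|x| * max 1 (gg N r / gg N 1)) ^ (1+1/m) * wt N r < e := by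
  set F : ℝ → ℝ → ℝ := fun x r => min (D * gg N r ^ ((1:ℝ)/2)) (|x| * max 1 (gg N r / gg N 1)) ^ (1+1/m) * wt N r with hF
  have hq : 0 < 1 + 1/m := by positivity
  have hmeas : ∀ x, AEStronglyMeasurable (F x) (volume.restrict (Ioi 0)) := by
    intro x
    refine AEMeasurable.aestronglyMeasurable ?_
    have hg := gg_meas hN
    exact ((((hg.pow_const ((1:ℝ)/2)).const_mul D).min ((aemeasurable_const.max (hg.div_const _)).const_mul |x|)).pow_const _).mul
      (wt_cont N).measurable.aemeasurable
  have hmin0 : ∀ x, ∀ r > 0, 0 ≤ min (D * gg N r ^ ((1:ℝ)/2)) (|x| * max 1 (gg N r / gg N 1)) := by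
    intro x r hr
    have := gg_pos hN hr
    refine le_min (by positivity) (mul_nonneg (abs_nonneg _) (le_max_of_le_left zero_le_one))
  have hbd : ∀ x, ∀ r > 0, ‖F x r‖ ≤ D ^ (1+1/m) * (gg N r ^ ((1+1/m)/2) * wt N r) := by
    intro x r hr
    have hg := gg_pos hN hr
    have hw := wt_pos (N := N) hr
    simp only [hF]
    rw [Real.norm_of_nonneg (mul_nonneg (Real.rpow_nonneg (hmin0 x r hr) _) hw.le), ← mul_assoc]
    refine mul_le_mul_of_nonneg_right ?_ hw.le
    calc _ ≤ (D * gg N r ^ ((1:ℝ)/2)) ^ (1+1/m) := Real.rpow_le_rpow (hmin0 x r hr) (min_le_left _ _) hq.le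
      _ = _ := by
        rw [Real.mul_rpow hD.le (Real.rpow_nonneg hg.le _), ← Real.rpow_mul hg.le]
        congr 2; ring
  have hint : ∀ x, IntegrableOn (F x) (Ioi 0) := by
    intro x
    refine Integrable.mono' (hK.const_mul (D ^ (1+1/m))) (hmeas x) ?_
    filter_upwards [self_mem_ae_restrict measurableSet_Ioi] with r hr
    exact hbd x r hr
  have ht : Tendsto (fun x => ∫ r in Ioi (0:ℝ), F x r) (𝓝 0) (𝓝 (∫ r in Ioi (0:ℝ), (0:ℝ))) := by
    refine tendsto_integral_filter_of_dominated_convergence (fun r => D ^ (1+1/m) * (gg N r ^ ((1+1/m)/2) * wt N r))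
      (Eventually.of_forall hmeas) (Eventually.of_forall fun x => ?_) (hK.const_mul _) ?_
    · filter_upwards [self_mem_ae_restrict measurableSet_Ioi] with r hr
      exact hbd x r hr
    · filter_upwards [self_mem_ae_restrict measurableSet_Ioi] with r hr
      have hg := gg_pos hN hr
      have c : Continuous (fun x => F x r) := by
        refine Continuous.mul (Continuous.rpow_const (by fun_prop) (fun _ => Or.inr hq.le)) continuous_const
      have h0 : F 0 r = 0 := by
        simp only [hF]
        rw [abs_zero, zero_mul, min_eq_right (by positivity), Real.zero_rpow hq.ne', zero_mul]
      have := c.tendsto 0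
      rwa [h0] at this
  rw [integral_zero] at ht
  have hev := ht.eventually (gt_mem_nhds he)
  rw [Metric.eventually_nhds_iff] at hev
  obtain ⟨x0, hx0, h⟩ := hev
  refine ⟨x0, hx0, fun x hx hx1 => ⟨hint x, h ?_⟩⟩
  rw [Real.dist_eq, sub_zero, abs_of_nonneg hx]; exact hx1

lemma U1_lower (hm0 : 0 < m) (hm1 : m < 1) (hN : 2 ≤ N) (hc : Core N m a T C v)
    (hK : IntegrableOn (fun r => gg N r ^ ((1+1/m)/2) * wt N r) (Ioi 0)) :
    ∃ c > 0, ∀ t ∈ Ico a T, c * (T-t)^(1/(1-m)) ≤ UU m T v 1 t := by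
  obtain ⟨c, hcp, low⟩ := BB_lower hm0 hN hc hK
  obtain ⟨⟨c1, hc1, hlo⟩, C1, hC1, hup⟩ := ext_rate hm0 hm1 hc.aT (BB_cont hm0 hN hc hK) (BB_nn hc)
    (fun s t ht => (AA_eq_BB hm0 hN hc hK s ht).2) (fun s hs t ht => AA_symm hm0 hN hc hK hs ht)
    (fun s hs t ht => AA_cs hm0 hN hc hK hs ht) (fun t ht => AA_pos hm0 hN hc hK ht)
    (BB_young hm0 hN hc hK) hcp low
  have hϑ : 0 < 1 - m := by linarith
  have hC := hc.hC
  set D := Real.sqrt (C1 * 2^(2/(1-m))) with hD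
  have hDp : 0 < D := Real.sqrt_pos.2 (by positivity)
  obtain ⟨x0, hx0, hψ⟩ := psi_small hm0 hN hK hDp (show 0 < c1 / C^(1/m) by positivity)
  refine ⟨x0 * (1/2)^(1/(1-m)), by positivity, fun t ht => ?_⟩
  by_contra! hlt
  have htC : t ∈ Icc a T := ⟨ht.1, ht.2.le⟩
  set s := (t+T)/2 with hs
  set τ := (T-t)/2 with hτ
  have hτp : 0 < τ := by rw [hτ]; linarith [ht.2]
  have hst : s - t = τ := by rw [hs, hτ]; ring
  have hTs : T - s = τ := by rw [hs, hτ]; ring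
  have hTt : T - t = 2 * τ := by rw [hτ]; ring
  have hsI : s ∈ Ico a T := ⟨by linarith [ht.1], by linarith⟩
  set e := τ^(1/(1-m)) with he
  have hep : 0 < e := Real.rpow_pos_of_pos hτp _
  have he2 : τ^(2/(1-m)) = e^2 := by
    rw [he, ← Real.rpow_natCast, ← Real.rpow_mul hτp.le]; congr 1; push_cast; ring
  have hem : e^(1/m) = e * τ^(1/m) := by
    rw [he, ← Real.rpow_mul hτp.le, ← Real.rpow_add hτp]; congr 1; field_simp; ring
  set x := UU m T v 1 t / e with hx
  have hx_nn : 0 ≤ x := div_nonneg (UU_nn hc ht.2.le 1) hep.le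
  have hxlt : x < x0 := by
    rw [hx, div_lt_iff₀ hep]
    refine hlt.trans_le (le_of_eq ?_)
    rw [mul_assoc, ← Real.mul_rpow (by norm_num) (by linarith), he]
    congr 2; rw [hτ]; ring
  obtain ⟨hi, hlt2⟩ := hψ x hx_nn hxlt
  set G : ℝ → ℝ := fun r => min (D * gg N r ^ ((1:ℝ)/2)) (|x| * max 1 (gg N r / gg N 1)) with hG
  have hV1 : ∀ r > 0, UU m T v r t ≤ e * G r := by
    intro r hr
    have hg := gg_pos hN hr
    have hg1 := gg_pos hN one_pos
    rw [mul_min_of_nonneg _ _ hep.le]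
    refine le_min ?_ ?_
    · have h1 := UU_E hm0 hN hc hK htC hr
      have h2 := hup t ht
      rw [hTt, Real.mul_rpow (by norm_num) hτp.le, he2] at h2
      refine abs_le_of_sq_le_sq' (h1.trans ?_) (by positivity) |>.2
      rw [mul_pow, mul_pow, ← Real.sqrt_eq_rpow, Real.sq_sqrt hg.le, hD, Real.sq_sqrt (by positivity)]
      calc _ ≤ gg N r * (C1 * (2^(2/(1-m)) * e^2)) := by gcongr
        _ = _ := by ring
    · rw [abs_of_nonneg hx_nn, ← mul_assoc, hx, mul_div_cancel₀ _ hep.ne']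
      rcases le_total r 1 with h | h
      · have h1 := UU_harnack hN hc htC hr h
        have h2 := UU_nn hc ht.2.le (1:ℝ)
        calc _ ≤ UU m T v 1 t * (gg N r / gg N 1) := by
              rw [← mul_div_assoc, le_div_iff₀ hg1]; exact h1
          _ ≤ _ := by gcongr; exact le_max_right _ _
      · have h1 := UU_anti hc htC one_pos h
        have h2 := UU_nn hc ht.2.le (1:ℝ)
        calc _ ≤ UU m T v 1 t * 1 := by linarith
          _ ≤ _ := by gcongr; exact le_max_left _ _
  have hpt : ∀ r ∈ Ioi (0:ℝ), v r s * UU m T v r s * wt N r ≤ (C^(1/m) * e^2) * (G r ^ (1+1/m) * wt N r) := by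
    intro r hr
    have hw := wt_pos (N := N) hr
    have hUt := UU_nn hc ht.2.le r
    have hb := hV1 r hr
    have hG0 : 0 ≤ G r := by
      by_contra! h
      nlinarith
    have h1 := w_le_UU hm0 hc ht.1 (show t ≤ s by linarith) hsI.2.le r
    rw [hst] at h1
    have h2 : v r s ^ m ≤ C / τ * (e * G r) := by
      rw [div_mul_eq_mul_div, le_div_iff₀ hτp, mul_comm]
      exact h1.trans (mul_le_mul_of_nonneg_left hb hC.le)
    have h3 : v r s ≤ (C / τ * (e * G r))^(1/m) := by
      have := Real.rpow_le_rpow (Real.rpow_nonneg (hc.nn r s) m) h2 (show 0 ≤ 1/m by positivity)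
      rwa [← Real.rpow_mul (hc.nn r s), mul_one_div_cancel hm0.ne', Real.rpow_one] at this
    have h4 : UU m T v r s ≤ e * G r := (UU_time hm0 hc (show t ≤ s by linarith) r).trans hb
    have e5 : (C / τ * (e * G r))^(1/m) = C^(1/m) * e * G r^(1/m) := by
      rw [Real.mul_rpow (by positivity) (by positivity), Real.mul_rpow hep.le hG0, Real.div_rpow hC.le hτp.le, hem]
      have : 0 < τ^(1/m) := Real.rpow_pos_of_pos hτp _
      field_simp
    rw [e5] at h3
    have e6 : G r^(1+1/m) = G r^(1/m) * G r := by
      rw [add_comm, Real.rpow_add_one' hG0 (by positivity)]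
    rw [← mul_assoc]
    refine mul_le_mul_of_nonneg_right ?_ hw.le
    calc _ ≤ (C^(1/m) * e * G r^(1/m)) * (e * G r) := mul_le_mul h3 h4 (UU_nn hc hsI.2.le r) (by positivity)
      _ = _ := by rw [e6]; ring
  have hfin := setIntegral_mono_on (AA_eq_BB hm0 hN hc hK s hsI.2.le).1 (hi.const_mul (C^(1/m) * e^2)) measurableSet_Ioi hpt
  rw [integral_const_mul] at hfin
  have hlos := hlo s hsI
  rw [hTs, he2] at hlos
  have hlos' : c1 * e^2 ≤ (C^(1/m) * e^2) * ∫ r in Ioi (0:ℝ), G r ^ (1+1/m) * wt N r := hlos.trans hfin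
  have hlt3 : (C^(1/m) * e^2) * (∫ r in Ioi (0:ℝ), G r ^ (1+1/m) * wt N r) < (C^(1/m) * e^2) * (c1 / C^(1/m)) :=
    mul_lt_mul_of_pos_left hlt2 (by positivity)
  have : (C^(1/m) * e^2) * (c1 / C^(1/m)) = c1 * e^2 := by
    have : 0 < C^(1/m) := by positivity
    field_simp
  linarith
end

theorem sharp_lower_bound
    (N : ℕ) (hN : 2 ≤ N) (m T : ℝ)
    (hm : m ∈ Set.Ioo (((N : ℝ) - 2) / ((N : ℝ) + 2)) 1) (hT : 0 < T)
    (u : ℝ → ℝ → ℝ) (hu : IsRadialEnergySolution N m T u) :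
    ∀ ε ∈ Set.Ioo (0:ℝ) T, ∃ P > (0:ℝ), ∀ r ∈ Set.Ici (0:ℝ), ∀ t ∈ Set.Ico ε T,
      P * Real.exp (-((N : ℝ) - 1) * r / m) * (T - t) ^ (1 / (1 - m)) ≤ u r t := by
  intro ε hε
  have hN' : (2:ℝ) ≤ N := by exact_mod_cast hN
  have hm0 : 0 < m := lt_of_le_of_lt (div_nonneg (by linarith) (by linarith)) hm.1
  have hm1 := hm.2
  have hϑ : 0 < 1 - m := by linarith
  have hmN : (N:ℝ) - 2 < m * ((N:ℝ)+2) := by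
    have := hm.1
    rwa [div_lt_iff₀ (by linarith)] at this
  have hp1 : 1 < (1 + 1/m)/2 := by
    have : 1 < 1/m := by rw [lt_div_iff₀ hm0]; linarith
    linarith
  have hp2 : (1 + 1/m)/2 * ((N:ℝ)-2) < N := by
    have e : (1 + 1/m)/2 * ((N:ℝ)-2) = (m+1) * ((N:ℝ)-2) / (2*m) := by field_simp
    rw [e, div_lt_iff₀ (by positivity)]
    nlinarith
  have hK := ggp_int hN hp1 hp2
  obtain ⟨C, v, hc, hvu⟩ := core_exists hN hm0 hm1 hu hε
  obtain ⟨c, hcp, hU1⟩ := U1_lower hm0 hm1 hN hc hK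
  have hg1 := gg_pos hN one_pos
  have hC := hc.hC
  have hN1 : 0 < (N:ℝ) - 1 := by linarith
  set k := min 1 (1/(((N:ℝ)-1) * gg N 1)) with hk
  have hkp : 0 < k := lt_min one_pos (by positivity)
  set P := (k * c / C)^(1/m) with hP
  refine ⟨P, by positivity, ?_⟩
  have main : ∀ r > 0, ∀ t ∈ Ico ε T, P * Real.exp (-((N : ℝ) - 1) * r / m) * (T - t) ^ (1 / (1 - m)) ≤ v r t := by
    intro r hr t ht
    have htC : t ∈ Icc ε T := ⟨ht.1, ht.2.le⟩
    have hTt : 0 < T - t := by linarith [ht.2]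
    have hg := gg_pos hN hr
    have h1 := hU1 t ht
    have hU1n := UU_nn hc ht.2.le (1:ℝ)
    set X := Real.exp (-((N:ℝ)-1) * r) with hX
    have hXp : 0 < X := Real.exp_pos _
    have h2 : k * X * UU m T v 1 t ≤ UU m T v r t := by
      rcases le_total r 1 with h | h
      · have h3 := UU_anti hc htC hr h
        have h4 : k * X ≤ 1 := by
          have : X ≤ 1 := by rw [hX, Real.exp_le_one_iff]; nlinarith
          have h5 : k ≤ 1 := min_le_left _ _
          nlinarith
        calc _ ≤ 1 * UU m T v 1 t := by gcongr
          _ ≤ _ := by linarith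
      · have h3 := UU_harnack hN hc htC one_pos h
        have h4 := gg_lb hN hr
        have h5 : k ≤ 1/(((N:ℝ)-1) * gg N 1) := min_le_right _ _
        have h6 : k * X * gg N 1 ≤ gg N r := by
          calc _ ≤ 1/(((N:ℝ)-1) * gg N 1) * X * gg N 1 := by gcongr
            _ = (1/((N:ℝ)-1)) * X := by field_simp
            _ ≤ _ := h4
        refine le_of_mul_le_mul_right ?_ hg1
        calc _ = (k * X * gg N 1) * UU m T v 1 t := by ring
          _ ≤ gg N r * UU m T v 1 t := by gcongr
          _ ≤ _ := by linarith
    have h3 := UU_le_w hm0 hc ht r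
    have h4 : k * X * (c * (T-t)^(1/(1-m))) ≤ (T-t) * (C * v r t ^ m) := by
      refine le_trans ?_ (h2.trans h3)
      gcongr
    have e1 : (T-t)^(1/(1-m)) = (T-t)^(m/(1-m)) * (T-t) := by
      rw [← Real.rpow_add_one hTt.ne']; congr 1; field_simp; ring
    have h5 : (k*c/C) * X * (T-t)^(m/(1-m)) ≤ v r t ^ m := by
      rw [e1] at h4
      refine le_of_mul_le_mul_right ?_ (mul_pos hTt hC)
      calc _ = k * X * (c * ((T-t)^(m/(1-m)) * (T-t))) := by field_simp
        _ ≤ _ := h4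
        _ = _ := by ring
    have h6 := Real.rpow_le_rpow (by positivity) h5 (show 0 ≤ 1/m by positivity)
    rw [← Real.rpow_mul (hc.nn r t), mul_one_div_cancel hm0.ne', Real.rpow_one, Real.mul_rpow (by positivity) (by positivity),
      Real.mul_rpow (by positivity) hXp.le, ← Real.rpow_mul hTt.le, hX, ← Real.exp_mul] at h6
    have e2 : m/(1-m) * (1/m) = 1/(1-m) := by field_simp
    have e3 : -((N:ℝ)-1) * r * (1/m) = -((N:ℝ)-1) * r / m := by ring
    rw [e2, e3] at h6
    exact h6
  intro r hr t ht
  rw [← hvu r hr t ⟨ht.1, ht.2.le⟩]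
  rcases (mem_Ici.1 hr).eq_or_lt with h | h
  · have cv : Continuous (fun r => v r t) := hc.cont.comp (f := fun r => (r, t)) (by fun_prop)
    have cl : Continuous (fun r => P * Real.exp (-((N : ℝ) - 1) * r / m) * (T - t) ^ (1 / (1 - m))) := by fun_prop
    refine le_of_tendsto_of_tendsto ((cl.tendsto r).mono_left (nhdsWithin_le_nhds (s := Ioi r))) ((cv.tendsto r).mono_left nhdsWithin_le_nhds) ?_
    filter_upwards [self_mem_nhdsWithin] with ρ hρ
    exact main ρ (lt_of_le_of_lt hr hρ) t ht
  · exact main r h t ht
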